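/- arXiv:1706.06310 — 4 statements merged into one kernel-verified Lean document; each statement's English description precedes it below -/
import Mathlib

section
/- Let n ≥ 2, p < 1, e ∈ S^{n-1}, and let f : S^{n-1} → (0,∞) be measurable. Let K ∈ K_0^n satisfy H^{n-1}({u ∈ S^{n-1} : h_K(u) = 0}) = 0 and S_K(ω) = ∫_ω f(u) h_K(u)^{p-1} dH^{n-1}(u) for every Borel set ω ⊆ {u ∈ S^{n-1} : h_K(u) > 0}. Define v on the hyperplane e^⊥ = {y ∈ ℝ^n : ⟨y,e⟩ = 0} by v(y) = h_K(y + e). Then H^{n-1}({y ∈ e^⊥ : v(y) = 0}) = 0, and for every Borel set ω ⊆ {y ∈ e^⊥ : v(y) > 0} one has H^{n-1}(⋃_{y∈ω} ∂v(y)) = ∫_ω g(y) v(y)^{p-1} dH^{n-1}(y), where ∂v(y) ⊆ e^⊥ is the subgradient of v viewed as a convex function on e^⊥, and g(y) = (1 + ‖y‖²)^{−(n+p)/2} · f((e + y)/√(1 + ‖y‖²)). -/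
open MeasureTheory Set
open scoped ENNReal NNReal RealInnerProductSpace

noncomputable section

/-- Support function of a set `K`. -/
def suppFn {n : ℕ} (K : Set (EuclideanSpace ℝ (Fin n))) (u : EuclideanSpace ℝ (Fin n)) : ℝ :=
  sSup ((fun y => ⟪u, y⟫) '' K)

/-- Face of `K` with outer normal `u`. -/
def face {n : ℕ} (K : Set (EuclideanSpace ℝ (Fin n))) (u : EuclideanSpace ℝ (Fin n)) :
    Set (EuclideanSpace ℝ (Fin n)) :=
  {z ∈ K | ⟪z, u⟫ = suppFn K u}

/-- Normal cone of `K` at `z`. -/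
def normalCone {n : ℕ} (K : Set (EuclideanSpace ℝ (Fin n))) (z : EuclideanSpace ℝ (Fin n)) :
    Set (EuclideanSpace ℝ (Fin n)) :=
  {u | ∀ y ∈ K, ⟪u, y⟫ ≤ ⟪u, z⟫}

/-- The unit sphere `S^{n-1}` in `ℝ^n`. -/
def unitSphere (n : ℕ) : Set (EuclideanSpace ℝ (Fin n)) :=
  Metric.sphere (0 : EuclideanSpace ℝ (Fin n)) 1

/-- Surface area measure of `K` evaluated on `ω`:
`S_K(ω) = H^{n-1}(⋃_{u ∈ ω} F(K,u))`. -/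
def surfMeas {n : ℕ} (K : Set (EuclideanSpace ℝ (Fin n)))
    (ω : Set (EuclideanSpace ℝ (Fin n))) : ℝ≥0∞ :=
  μH[(n : ℝ) - 1] (⋃ u ∈ ω, face K u)

/-- `K ∈ 𝒦₀ⁿ`: compact convex with nonempty interior, containing the origin. -/
def IsConvexBody0 {n : ℕ} (K : Set (EuclideanSpace ℝ (Fin n))) : Prop :=
  IsCompact K ∧ Convex ℝ K ∧ (interior K).Nonempty ∧ (0 : EuclideanSpace ℝ (Fin n)) ∈ K

/-- `K` is a solution of the `L_p` Minkowski problem `dS_{K,p} = f dH^{n-1}`. -/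
def IsLpSolution {n : ℕ} (p : ℝ) (f : EuclideanSpace ℝ (Fin n) → ℝ)
    (K : Set (EuclideanSpace ℝ (Fin n))) : Prop :=
  μH[(n : ℝ) - 1] {u ∈ unitSphere n | suppFn K u = 0} = 0 ∧
  ∀ ω : Set (EuclideanSpace ℝ (Fin n)), MeasurableSet ω →
    ω ⊆ {u ∈ unitSphere n | 0 < suppFn K u} →
    surfMeas K ω
      = ∫⁻ u in ω, ENNReal.ofReal ((n : ℝ) * f u * suppFn K u ^ (p - 1)) ∂μH[(n : ℝ) - 1]

/-- `x` is a smooth boundary point: the normal cone spans a one-dimensional space. -/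
def IsSmoothPt {n : ℕ} (K : Set (EuclideanSpace ℝ (Fin n)))
    (x : EuclideanSpace ℝ (Fin n)) : Prop :=
  Module.finrank ℝ (Submodule.span ℝ (normalCone K x)) = 1

/-- `K` is smooth: every boundary point is a smooth point. -/
def IsSmoothBody {n : ℕ} (K : Set (EuclideanSpace ℝ (Fin n))) : Prop :=
  ∀ x ∈ frontier K, IsSmoothPt K x

/-- Subgradient of `v` at `x` relative to the domain `Ω`. -/
def subgrad {n : ℕ} (Ω : Set (EuclideanSpace ℝ (Fin n))) (v : EuclideanSpace ℝ (Fin n) → ℝ)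
    (x : EuclideanSpace ℝ (Fin n)) : Set (EuclideanSpace ℝ (Fin n)) :=
  {z | ∀ y ∈ Ω, v x + ⟪z, y - x⟫ ≤ v y}

/-- Monge–Ampère measure of `v` (relative to domain `Ω`) evaluated on `ω`. -/
def maMeasure {n : ℕ} (Ω : Set (EuclideanSpace ℝ (Fin n))) (v : EuclideanSpace ℝ (Fin n) → ℝ)
    (ω : Set (EuclideanSpace ℝ (Fin n))) : ℝ≥0∞ :=
  μH[(n : ℝ)] (⋃ x ∈ ω, subgrad Ω v x)

/-- Hessian matrix of `v : ℝ^n → ℝ` at `x`. -/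
def hessMatrix {n : ℕ} (v : EuclideanSpace ℝ (Fin n) → ℝ) (x : EuclideanSpace ℝ (Fin n)) :
    Matrix (Fin n) (Fin n) ℝ :=
  Matrix.of fun i j =>
    fderiv ℝ (fun y => fderiv ℝ v y (EuclideanSpace.single j 1)) x (EuclideanSpace.single i 1)

/-- Orthogonal projection along a unit vector. -/
def prj {n : ℕ} (a x : EuclideanSpace ℝ (Fin n)) : EuclideanSpace ℝ (Fin n) := x - ⟪x, a⟫ • a

lemma haus_image_le {X Y Z : Type*} [MetricSpace X] [MeasurableSpace X] [BorelSpace X]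
    [MetricSpace Z] [MeasurableSpace Z] [BorelSpace Z]
    (F : Y → X) (G : Y → Z) (A : Set Y) {c d : ℝ} (hc : 0 ≤ c) (hd : 0 ≤ d)
    (h : ∀ x ∈ A, ∀ y ∈ A, dist (F x) (F y) ≤ c * dist (G x) (G y)) :
    μH[d] (F '' A) ≤ ENNReal.ofReal (c ^ d) * μH[d] (G '' A) := by
  classical
  rcases A.eq_empty_or_nonempty with rfl | ⟨a0, ha0⟩
  · simp
  have : Nonempty Y := ⟨a0⟩
  have hinv : ∀ z ∈ G '' A, Function.invFunOn G A z ∈ A ∧ G (Function.invFunOn G A z) = z := by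
    intro z hz
    exact ⟨Function.invFunOn_mem hz, Function.invFunOn_eq hz⟩
  have hL : LipschitzOnWith (Real.toNNReal c) (fun z => F (Function.invFunOn G A z)) (G '' A) := by
    refine LipschitzOnWith.of_dist_le_mul ?_
    intro z hz w hw
    rw [Real.coe_toNNReal c hc]
    have := h _ (hinv z hz).1 _ (hinv w hw).1
    rwa [(hinv z hz).2, (hinv w hw).2] at this
  have himg : F '' A ⊆ (fun z => F (Function.invFunOn G A z)) '' (G '' A) := by
    rintro _ ⟨x, hx, rfl⟩
    refine ⟨G x, ⟨x, hx, rfl⟩, ?_⟩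
    have h1 := hinv (G x) ⟨x, hx, rfl⟩
    have := h _ h1.1 x hx
    rw [h1.2] at this
    simp only [dist_self, mul_zero] at this
    exact dist_le_zero.1 this
  refine (measure_mono himg).trans ((hL.hausdorffMeasure_image_le hd).trans_eq ?_)
  rw [← ENNReal.ofReal_rpow_of_nonneg hc hd]; rfl

lemma haus_linear {n : ℕ} (hn : 2 ≤ n) {a b : EuclideanSpace ℝ (Fin n)} (ha : ‖a‖ = 1)
    (hb : ‖b‖ = 1) (B : Set (EuclideanSpace ℝ (Fin n))) (hB : ∀ x ∈ B, ⟪x, a⟫ = 0) :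
    μH[(n : ℝ) - 1] (prj b '' B) = ENNReal.ofReal |⟪a, b⟫| * μH[(n : ℝ) - 1] B := by
  have hd : (0:ℝ) ≤ (n:ℝ) - 1 := by
    have : (2:ℝ) ≤ n := by exact_mod_cast hn
    linarith
  have haa : ⟪a, a⟫ = (1:ℝ) := by rw [real_inner_self_eq_norm_sq, ha]; norm_num
  have hbb : ⟪b, b⟫ = (1:ℝ) := by rw [real_inner_self_eq_norm_sq, hb]; norm_num
  by_cases hab : a = b
  · subst hab
    have : prj a '' B = B := by
      have : ∀ x ∈ B, prj a x = x := fun x hx => by simp [prj, hB x hx]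
      rw [Set.image_congr this, Set.image_id']
    rw [this, haa]; simp
  set c : ℝ := ⟪a, b⟫ with hc
  have hc1 : c ≠ 1 := fun h => hab ((inner_eq_one_iff_of_norm_eq_one ha hb).1 h)
  have hc1' : 1 - c ≠ 0 := fun h => hc1 (by linarith)
  have : Fact (Module.finrank ℝ (EuclideanSpace ℝ (Fin n)) = (n - 1) + 1) :=
    ⟨by simp; omega⟩
  have ha0 : a ≠ 0 := by intro h; rw [h] at ha; simp at ha
  set V : Submodule ℝ (EuclideanSpace ℝ (Fin n)) := (ℝ ∙ a)ᗮ with hV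
  have hfr : Module.finrank ℝ V = n - 1 := Submodule.finrank_orthogonal_span_singleton ha0
  have hdim : (n:ℝ) - 1 = (Module.finrank ℝ V : ℕ) := by
    rw [hfr, Nat.cast_sub (by omega)]; simp
  have hmemV : ∀ x, x ∈ V ↔ ⟪x, a⟫ = 0 := by
    intro x
    rw [hV, Submodule.mem_orthogonal_singleton_iff_inner_left]
  let R := Submodule.reflection (ℝ ∙ (a - b))ᗮ
  have hb' : b - c • a ∈ V := by
    rw [hmemV, inner_sub_left, inner_smul_left, haa, real_inner_comm]; simp [hc]
  let b' : V := ⟨b - c • a, hb'⟩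
  let φ : Module.Dual ℝ V := (innerSL ℝ b').toLinearMap
  let T : V →ₗ[ℝ] V := LinearMap.transvection φ (-(1 - c)⁻¹ • b')
  have hnn : ‖a - b‖ ^ 2 = 2 * (1 - c) := by
    rw [norm_sub_sq_real, ha, hb]; ring
  have hdet : LinearMap.det T = - c := by
    rw [LinearMap.transvection.det]
    have : φ (-(1 - c)⁻¹ • b') = -(1 - c)⁻¹ * (1 - c^2) := by
      have h2 : ⟪b - c • a, b - c • a⟫ = 1 - c^2 := by
        simp only [inner_sub_left, inner_sub_right, inner_smul_left, inner_smul_right, haa, hbb,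
          real_inner_comm a b, ← hc, conj_trivial]
        ring
      rw [map_smul]
      change _ • ⟪b - c • a, b - c • a⟫ = _
      rw [h2]; rfl
    rw [this]; field_simp; ring
  have hRT : ∀ x : V, R (prj b x) = T x := by
    intro x
    have hx : ⟪(x : EuclideanSpace ℝ (Fin n)), a⟫ = 0 := (hmemV _).1 x.2
    have hx' : ⟪a, (x : EuclideanSpace ℝ (Fin n))⟫ = 0 := by rw [real_inner_comm]; exact hx
    have e1 : R (prj b x) = -(2 • (⟪a - b, prj b x⟫ / (‖a - b‖ ^ 2)) • (a - b) - prj b x) := by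
      have := Submodule.reflection_orthogonal_apply (ℝ ∙ (a - b)) (prj b x)
      rw [Submodule.reflection_singleton_apply] at this
      exact this
    have e2 : (T x : EuclideanSpace ℝ (Fin n)) = x + ⟪b - c • a, (x : EuclideanSpace ℝ (Fin n))⟫ • (-(1 - c)⁻¹ • (b - c • a)) := rfl
    rw [e1, e2, hnn]
    have i1 : ⟪a - b, prj b x⟫ = - c * ⟪b, (x : EuclideanSpace ℝ (Fin n))⟫ := by
      simp only [prj, inner_sub_left, inner_sub_right, inner_smul_right, hbb, hx', ← hc]
      rw [real_inner_comm]; ring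
    have i2 : ⟪b - c • a, (x : EuclideanSpace ℝ (Fin n))⟫ = ⟪b, (x : EuclideanSpace ℝ (Fin n))⟫ := by
      simp [inner_sub_left, inner_smul_left, hx']
    rw [i1, i2]
    set t := ⟪b, (x : EuclideanSpace ℝ (Fin n))⟫ with ht
    rw [prj, real_inner_comm, ← ht]
    have k1 : -c * t / (2 * (1 - c)) = -(c * t * (1 - c)⁻¹) / 2 := by field_simp
    have k2 : (1 - c) * (1 - c)⁻¹ = 1 := mul_inv_cancel₀ hc1'
    rw [k1]
    have k3 : c * (1-c)⁻¹ = (1-c)⁻¹ - 1 := by linear_combination -k2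
    match_scalars
    · ring
    · linear_combination (-t) * k3
    · ring
  set B' : Set V := (fun x : V => (x : EuclideanSpace ℝ (Fin n))) ⁻¹' B with hB'
  have hBB : (fun x : V => (x : EuclideanSpace ℝ (Fin n))) '' B' = B := by
    ext x; constructor
    · rintro ⟨y, hy, rfl⟩; exact hy
    · intro hx; exact ⟨⟨x, (hmemV x).2 (hB x hx)⟩, hx, rfl⟩
  have hiso : Isometry (fun x : V => (x : EuclideanSpace ℝ (Fin n))) := isometry_subtype_coe
  calc μH[(n : ℝ) - 1] (prj b '' B) = μH[(n : ℝ) - 1] (R '' (prj b '' B)) :=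
        (R.isometry.hausdorffMeasure_image (Or.inl hd) _).symm
    _ = μH[(n : ℝ) - 1] ((fun x : V => (x : EuclideanSpace ℝ (Fin n))) '' (T '' B')) := by
        rw [← hBB, Set.image_image, Set.image_image, Set.image_image]
        congr 1
        exact Set.image_congr fun x _ => hRT x
    _ = μH[(n : ℝ) - 1] (T '' B') := hiso.hausdorffMeasure_image (Or.inl hd) _
    _ = ENNReal.ofReal |c| * μH[(n : ℝ) - 1] B' := by
        rw [hdim, Measure.addHaar_image_linearMap, hdet, abs_neg]
    _ = _ := by rw [← hBB, hiso.hausdorffMeasure_image (Or.inl hd)]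

lemma haus_bounded {n : ℕ} (hn : 2 ≤ n) {a : EuclideanSpace ℝ (Fin n)} (ha : ‖a‖ = 1)
    (B : Set (EuclideanSpace ℝ (Fin n))) (hB : ∀ x ∈ B, ⟪x, a⟫ = 0)
    (hb : Bornology.IsBounded B) : μH[(n : ℝ) - 1] B ≠ ⊤ := by
  have hd : (0:ℝ) ≤ (n:ℝ) - 1 := by
    have : (2:ℝ) ≤ n := by exact_mod_cast hn
    linarith
  have : Fact (Module.finrank ℝ (EuclideanSpace ℝ (Fin n)) = (n - 1) + 1) :=
    ⟨by simp; omega⟩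
  have ha0 : a ≠ 0 := by intro h; rw [h] at ha; simp at ha
  set V : Submodule ℝ (EuclideanSpace ℝ (Fin n)) := (ℝ ∙ a)ᗮ with hV
  have hfr : Module.finrank ℝ V = n - 1 := Submodule.finrank_orthogonal_span_singleton ha0
  have hdim : (n:ℝ) - 1 = (Module.finrank ℝ V : ℕ) := by
    rw [hfr, Nat.cast_sub (by omega)]; simp
  have hmemV : ∀ x, x ∈ V ↔ ⟪x, a⟫ = 0 := by
    intro x
    rw [hV, Submodule.mem_orthogonal_singleton_iff_inner_left]
  set B' : Set V := (fun x : V => (x : EuclideanSpace ℝ (Fin n))) ⁻¹' B with hB'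
  have hBB : (fun x : V => (x : EuclideanSpace ℝ (Fin n))) '' B' = B := by
    ext x; constructor
    · rintro ⟨y, hy, rfl⟩; exact hy
    · intro hx; exact ⟨⟨x, (hmemV x).2 (hB x hx)⟩, hx, rfl⟩
  have hiso : Isometry (fun x : V => (x : EuclideanSpace ℝ (Fin n))) := isometry_subtype_coe
  rw [← hBB, hiso.hausdorffMeasure_image (Or.inl hd), hdim]
  have : Bornology.IsBounded B' := hiso.antilipschitz.isBounded_preimage hb
  exact this.measure_lt_top.ne

lemma local_le {X : Type*} [TopologicalSpace X] [SecondCountableTopology X] [MeasurableSpace X]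
    [BorelSpace X] (D : Set X) (Q : Set X → Prop) (ν μ : Set X → ℝ≥0∞)
    (hν : ∀ E : ℕ → Set X, (∀ i, MeasurableSet (E i)) → (∀ i, E i ⊆ D) →
      Pairwise (Function.onFun Disjoint E) → ν (⋃ i, E i) ≤ ∑' i, ν (E i))
    (hμ : ∀ E : ℕ → Set X, (∀ i, MeasurableSet (E i)) → (∀ i, E i ⊆ D) → (∀ i, Q (E i)) →
      Pairwise (Function.onFun Disjoint E) → ∑' i, μ (E i) ≤ μ (⋃ i, E i))
    (hν0 : ν ∅ = 0)
    (hloc : ∀ x ∈ D, ∀ c : ℝ, 1 < c → ∃ U ∈ nhds x, ∀ E, MeasurableSet E → E ⊆ U → E ⊆ D →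
      Q E ∧ ν E ≤ ENNReal.ofReal c * μ E)
    (E : Set X) (hE : MeasurableSet E) (hED : E ⊆ D) : ν E ≤ μ E := by
  have key : ∀ c : ℝ, 1 < c → ν E ≤ ENNReal.ofReal c * μ E := by
    intro c hc
    rcases E.eq_empty_or_nonempty with hE0 | ⟨x0, hx0⟩
    · subst hE0
      simp [hν0]
    choose! U hU hUE using fun x (hx : x ∈ D) => hloc x hx c hc
    obtain ⟨t, htE, htc, htcov⟩ := TopologicalSpace.countable_cover_nhdsWithin (s := E)
      (f := fun x => interior (U x)) (fun x hx => mem_nhdsWithin_of_mem_nhds (interior_mem_nhds.2 (hU x (hED hx))))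
    have htne : t.Nonempty := by
      have := htcov hx0
      simp only [mem_iUnion] at this
      obtain ⟨i, hi, _⟩ := this
      exact ⟨i, hi⟩
    obtain ⟨s, hs⟩ := htc.exists_eq_range htne
    let G : ℕ → Set X := fun i => E ∩ interior (U (s i))
    have hG : ∀ i, MeasurableSet (G i) := fun i => hE.inter isOpen_interior.measurableSet
    have hGU : ⋃ i, disjointed G i = E := by
      rw [iUnion_disjointed]
      apply subset_antisymm (iUnion_subset fun i => inter_subset_left)
      intro x hx
      have := htcov hx
      rw [hs] at this
      simp only [mem_iUnion, mem_range] at this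
      obtain ⟨_, ⟨i, rfl⟩, hi⟩ := this
      exact mem_iUnion.2 ⟨i, hx, hi⟩
    have hdm : ∀ i, MeasurableSet (disjointed G i) := fun i => MeasurableSet.disjointed hG i
    have hsub : ∀ i, disjointed G i ⊆ G i := fun i => disjointed_subset G i
    have hsD : ∀ i, s i ∈ D := fun i => hED (htE (by rw [hs]; exact mem_range_self i))
    have hloc' := fun i => hUE (s i) (hsD i) (disjointed G i) (hdm i)
      ((hsub i).trans (inter_subset_right.trans interior_subset))
      ((hsub i).trans (inter_subset_left.trans hED))
    have hsubD : ∀ i, disjointed G i ⊆ D := fun i => (hsub i).trans (inter_subset_left.trans hED)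
    calc ν E = ν (⋃ i, disjointed G i) := by rw [hGU]
      _ ≤ ∑' i, ν (disjointed G i) := hν _ hdm hsubD (disjoint_disjointed G)
      _ ≤ ∑' i, ENNReal.ofReal c * μ (disjointed G i) :=
          ENNReal.tsum_le_tsum fun i => (hloc' i).2
      _ = ENNReal.ofReal c * ∑' i, μ (disjointed G i) := ENNReal.tsum_mul_left
      _ ≤ ENNReal.ofReal c * μ (⋃ i, disjointed G i) := by
          gcongr
          exact hμ _ hdm hsubD (fun i => (hloc' i).1) (disjoint_disjointed G)
      _ = ENNReal.ofReal c * μ E := by rw [hGU]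
  have hlim : Filter.Tendsto (fun c : ℝ => ENNReal.ofReal c * μ E) (nhdsWithin 1 (Ioi 1))
      (nhds (1 * μ E)) := by
    refine ENNReal.Tendsto.mul_const ?_ (Or.inl one_ne_zero)
    have : Filter.Tendsto ENNReal.ofReal (nhds 1) (nhds 1) := by
      simpa using ENNReal.continuous_ofReal.tendsto (1:ℝ)
    exact this.mono_left nhdsWithin_le_nhds
  rw [one_mul] at hlim
  exact ge_of_tendsto hlim (by filter_upwards [self_mem_nhdsWithin] with c hc using key c hc)

/-- The Jacobian base factor. -/
def sfac {n : ℕ} (y : EuclideanSpace ℝ (Fin n)) : ℝ := Real.sqrt (1 + ‖y‖ ^ 2)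

/-- Inverse gnomonic projection. -/
def phi {n : ℕ} (e y : EuclideanSpace ℝ (Fin n)) : EuclideanSpace ℝ (Fin n) :=
  (Real.sqrt (1 + ‖y‖ ^ 2))⁻¹ • (e + y)

lemma sfac_pos {n : ℕ} (y : EuclideanSpace ℝ (Fin n)) : 0 < sfac y := by
  unfold sfac; positivity

lemma sfac_sq {n : ℕ} (y : EuclideanSpace ℝ (Fin n)) : sfac y ^ 2 = 1 + ‖y‖ ^ 2 := by
  unfold sfac; rw [Real.sq_sqrt]; positivity

lemma one_le_sfac {n : ℕ} (y : EuclideanSpace ℝ (Fin n)) : 1 ≤ sfac y := by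
  unfold sfac; rw [Real.one_le_sqrt]; nlinarith [sq_nonneg ‖y‖]

lemma sfac_cont {n : ℕ} : Continuous (sfac : EuclideanSpace ℝ (Fin n) → ℝ) := by
  unfold sfac; fun_prop

lemma phi_eq {n : ℕ} (e y : EuclideanSpace ℝ (Fin n)) : phi e y = (sfac y)⁻¹ • (e + y) := rfl

lemma phi_norm {n : ℕ} {e y : EuclideanSpace ℝ (Fin n)} (he : ‖e‖ = 1) (hy : ⟪y, e⟫ = 0) :
    ‖phi e y‖ = 1 := by
  have h : ‖e + y‖ ^ 2 = sfac y ^ 2 := by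
    rw [norm_add_sq_real, he, real_inner_comm, hy, sfac_sq]; ring
  have h2 : ‖e + y‖ = sfac y := by
    rw [← abs_of_nonneg (norm_nonneg (e + y)), ← abs_of_pos (sfac_pos y)]
    exact (sq_eq_sq_iff_abs_eq_abs _ _).1 h
  rw [phi_eq, norm_smul, h2, norm_inv, Real.norm_of_nonneg (sfac_pos y).le]
  exact inv_mul_cancel₀ (sfac_pos y).ne'

lemma phi_inner {n : ℕ} {e y : EuclideanSpace ℝ (Fin n)} (he : ‖e‖ = 1) (hy : ⟪y, e⟫ = 0) :
    ⟪phi e y, e⟫ = (sfac y)⁻¹ := by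
  rw [phi_eq, inner_smul_left, inner_add_left, hy, real_inner_self_eq_norm_sq, he]; simp

lemma phi_cont {n : ℕ} (e : EuclideanSpace ℝ (Fin n)) : Continuous (phi e) := by
  have : phi e = fun y => (sfac y)⁻¹ • (e + y) := rfl
  rw [this]
  exact (sfac_cont.inv₀ fun y => (sfac_pos y).ne').smul (by fun_prop)

lemma phi_injOn {n : ℕ} {e : EuclideanSpace ℝ (Fin n)} (he : ‖e‖ = 1) :
    InjOn (phi e) {y | ⟪y, e⟫ = 0} := by
  intro y hy z hz h
  have h1 : (sfac y)⁻¹ = (sfac z)⁻¹ := by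
    rw [← phi_inner he hy, ← phi_inner he hz, h]
  rw [phi_eq, phi_eq, h1] at h
  have := smul_right_injective _ (inv_ne_zero (sfac_pos z).ne') h
  simpa using this

lemma prj_lower {n : ℕ} {a b d : EuclideanSpace ℝ (Fin n)} (ha : ‖a‖ = 1) (hb : ‖b‖ = 1)
    (hd : ⟪d, a⟫ = 0) : |⟪a, b⟫| * ‖d‖ ≤ ‖prj b d‖ := by
  have h1 : ‖prj b d‖ ^ 2 = ‖d‖ ^ 2 - ⟪d, b⟫ ^ 2 := by
    rw [prj, norm_sub_sq_real, norm_smul, hb, inner_smul_right, Real.norm_eq_abs, mul_one, sq_abs]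
    ring
  have h2 : ⟪d, b⟫ = ⟪d, b - ⟪a, b⟫ • a⟫ := by
    rw [inner_sub_right, inner_smul_right, hd]; ring
  have h3 : ‖b - ⟪a, b⟫ • a‖ ^ 2 = 1 - ⟪a, b⟫ ^ 2 := by
    rw [norm_sub_sq_real, norm_smul, ha, hb, inner_smul_right, Real.norm_eq_abs, mul_one, sq_abs,
      real_inner_comm]
    ring
  have h4 : ⟪d, b⟫ ^ 2 ≤ ‖d‖ ^ 2 * (1 - ⟪a, b⟫ ^ 2) := by
    rw [← h3, h2, ← mul_pow, ← h2, h2, ← sq_abs]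
    gcongr
    exact abs_real_inner_le_norm _ _
  refine abs_le_of_sq_le_sq' ?_ (norm_nonneg _) |>.2
  rw [h1, mul_pow, sq_abs]
  linarith

lemma prj_sub {n : ℕ} (a x y : EuclideanSpace ℝ (Fin n)) : prj a x - prj a y = prj a (x - y) := by
  simp only [prj, inner_sub_left]; module

lemma prj_norm_le {n : ℕ} {a : EuclideanSpace ℝ (Fin n)} (ha : ‖a‖ = 1)
    (x : EuclideanSpace ℝ (Fin n)) : ‖prj a x‖ ≤ ‖x‖ := by
  refine abs_le_of_sq_le_sq' ?_ (norm_nonneg _) |>.2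
  rw [prj, norm_sub_sq_real, norm_smul, ha, inner_smul_right, Real.norm_eq_abs, mul_one, sq_abs]
  nlinarith [sq_nonneg ⟪x, a⟫]

lemma prj_inner {n : ℕ} {a : EuclideanSpace ℝ (Fin n)} (ha : ‖a‖ = 1)
    (x : EuclideanSpace ℝ (Fin n)) : ⟪prj a x, a⟫ = 0 := by
  rw [prj, inner_sub_left, inner_smul_left, real_inner_self_eq_norm_sq, ha]; simp

lemma near_norm {F : Type*} [NormedAddCommGroup F] {x y : F} {δ κ r : ℝ} (hr : 1 < r)
    (hxy : ‖x - y‖ ≤ κ * (1 - r⁻¹) * δ) (hy : κ * δ ≤ ‖y‖) : ‖x‖ ≤ r * ‖y‖ ∧ ‖y‖ ≤ r * ‖x‖ := by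
  have hr0 : 0 < r := by linarith
  have hr1 : r⁻¹ < 1 := inv_lt_one_of_one_lt₀ hr
  have hri : r * r⁻¹ = 1 := mul_inv_cancel₀ hr0.ne'
  have h1 : ‖x - y‖ ≤ (1 - r⁻¹) * ‖y‖ := by
    calc _ ≤ (1 - r⁻¹) * (κ * δ) := by linarith
      _ ≤ _ := by gcongr
  have h2 : ‖x‖ ≤ ‖x - y‖ + ‖y‖ := by simpa using norm_add_le (x - y) y
  have h3 : ‖y‖ ≤ ‖x - y‖ + ‖x‖ := by
    have := norm_add_le (y - x) x
    rw [norm_sub_rev y x] at this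
    simpa using this
  constructor
  · have : 1 + (1 - r⁻¹) ≤ r := by
      have : 2 ≤ r + r⁻¹ := by
        have h5 : 0 ≤ (r - 1) * (1 - r⁻¹) := mul_nonneg (by linarith) (by linarith)
        nlinarith
      linarith
    nlinarith [norm_nonneg y]
  · have : r⁻¹ * ‖y‖ ≤ ‖x‖ := by linarith
    calc ‖y‖ = r * (r⁻¹ * ‖y‖) := by rw [← mul_assoc, hri, one_mul]
      _ ≤ _ := by gcongr

lemma exists_rt {c d : ℝ} (hc : 1 < c) (hd : 0 ≤ d) : ∃ r : ℝ, 1 < r ∧ r ^ d ≤ c := by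
  refine ⟨c ^ (1 / (d + 1)), Real.one_lt_rpow hc (by positivity), ?_⟩
  rw [← Real.rpow_mul (by linarith)]
  calc c ^ (1 / (d + 1) * d) ≤ c ^ (1:ℝ) := by
        apply Real.rpow_le_rpow_of_exponent_le hc.le
        rw [one_div_mul_eq_div, div_le_one (by positivity)]; linarith
    _ = c := Real.rpow_one c

lemma phi_deriv {n : ℕ} (e y0 : EuclideanSpace ℝ (Fin n)) :
    HasStrictFDerivAt (phi e) ((sfac y0)⁻¹ • ContinuousLinearMap.id ℝ (EuclideanSpace ℝ (Fin n))
      + (-((sfac y0)⁻¹ ^ 3) • innerSL ℝ y0).smulRight (e + y0)) y0 := by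
  have h1 : HasStrictFDerivAt (fun y : EuclideanSpace ℝ (Fin n) => 1 + ‖y‖ ^ 2)
      (2 • innerSL ℝ y0) y0 := (hasStrictFDerivAt_norm_sq y0).const_add 1
  have hpos : (1 + ‖y0‖ ^ 2) ≠ 0 := by positivity
  have h2 : HasStrictDerivAt (fun t : ℝ => (Real.sqrt t)⁻¹)
      (-((Real.sqrt (1 + ‖y0‖ ^ 2)) ^ 2)⁻¹ * (1 / (2 * Real.sqrt (1 + ‖y0‖ ^ 2)))) (1 + ‖y0‖ ^ 2) :=
    (hasStrictDerivAt_inv (by positivity)).comp _ (Real.hasStrictDerivAt_sqrt hpos)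
  have h3 := h2.comp_hasStrictFDerivAt y0 h1
  have h4 : HasStrictFDerivAt (fun y : EuclideanSpace ℝ (Fin n) => e + y)
      (ContinuousLinearMap.id ℝ _) y0 := (hasStrictFDerivAt_id y0).const_add e
  have h5 := h3.smul h4
  refine h5.congr_fderiv ?_
  ext1 w
  have hs := sfac_pos y0
  simp only [add_apply, smul_apply,
    ContinuousLinearMap.smulRight_apply, ContinuousLinearMap.id_apply, innerSL_apply_apply]
  change (sfac y0)⁻¹ • w + ((-((sfac y0) ^ 2)⁻¹ * (1 / (2 * sfac y0))) • (2 • ⟪y0, w⟫)) • (e + y0) = _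
  congr 2
  simp only [smul_eq_mul, nsmul_eq_mul, Nat.cast_ofNat]
  field_simp

lemma gno_local {n : ℕ} (hn : 2 ≤ n) {e y0 : EuclideanSpace ℝ (Fin n)} (he : ‖e‖ = 1)
    (hy0 : ⟪y0, e⟫ = 0) {c : ℝ} (hc : 1 < c) :
    ∃ U ∈ nhds y0, ∀ E ⊆ U, (∀ y ∈ E, ⟪y, e⟫ = 0) →
      μH[(n : ℝ) - 1] (phi e '' E) ≤ ENNReal.ofReal c *
        (ENNReal.ofReal ((sfac y0)⁻¹ ^ n) * μH[(n : ℝ) - 1] E) ∧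
      ENNReal.ofReal ((sfac y0)⁻¹ ^ n) * μH[(n : ℝ) - 1] E ≤
        ENNReal.ofReal c * μH[(n : ℝ) - 1] (phi e '' E) := by
  have hd : (0:ℝ) ≤ (n:ℝ) - 1 := by
    have : (2:ℝ) ≤ n := by exact_mod_cast hn
    linarith
  obtain ⟨r, hr, hrc⟩ := exists_rt hc hd
  have hr1 : r⁻¹ < 1 := inv_lt_one_of_one_lt₀ hr
  have hs := sfac_pos y0
  set s0 := sfac y0 with hs0
  set u0 := phi e y0 with hu0
  have hu0n : ‖u0‖ = 1 := phi_norm he hy0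
  have hu0e : ⟪e, u0⟫ = s0⁻¹ := by rw [real_inner_comm]; exact phi_inner he hy0
  have hκ : 0 < s0⁻¹ * s0⁻¹ := by positivity
  have hε : 0 < s0⁻¹ * s0⁻¹ * (1 - r⁻¹) := mul_pos hκ (by linarith)
  obtain ⟨U, hU, hUA⟩ := (phi_deriv e y0).approximates_deriv_on_nhds
    (c := Real.toNNReal (s0⁻¹ * s0⁻¹ * (1 - r⁻¹))) (Or.inr (by simpa using hε))
  refine ⟨U, hU, fun E hEU hE => ?_⟩
  have key : ∀ x ∈ E, ∀ y ∈ E, ‖phi e x - phi e y‖ ≤ r * ‖s0⁻¹ • prj u0 (x - y)‖ ∧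
      ‖s0⁻¹ • prj u0 (x - y)‖ ≤ r * ‖phi e x - phi e y‖ := by
    intro x hx y hy
    have hperp : ⟪x - y, e⟫ = 0 := by rw [inner_sub_left, hE x hx, hE y hy, sub_zero]
    have h1 := hUA x (hEU hx) y (hEU hy)
    rw [Real.coe_toNNReal _ hε.le] at h1
    have h2 : (s0⁻¹ • ContinuousLinearMap.id ℝ (EuclideanSpace ℝ (Fin n))
      + (-(s0⁻¹ ^ 3) • innerSL ℝ y0).smulRight (e + y0)) (x - y) = s0⁻¹ • prj u0 (x - y) := by
      simp only [add_apply, smul_apply,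
        ContinuousLinearMap.smulRight_apply, ContinuousLinearMap.id_apply, innerSL_apply_apply]
      rw [prj, hu0, phi_eq, ← hs0, inner_smul_right, inner_add_right, hperp, real_inner_comm]
      simp only [smul_eq_mul]
      module
    rw [h2] at h1
    refine near_norm (δ := ‖x - y‖) (κ := s0⁻¹ * s0⁻¹) hr h1 ?_
    rw [norm_smul, Real.norm_of_nonneg (by positivity), mul_assoc]
    gcongr
    have := prj_lower he hu0n hperp
    rwa [hu0e, abs_of_pos (by positivity)] at this
  have hlin := haus_linear hn he hu0n E hE
  rw [hu0e, abs_of_pos (by positivity)] at hlin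
  have hpow : s0⁻¹ ^ ((n:ℝ) - 1) * s0⁻¹ = s0⁻¹ ^ n := by
    rw [← Real.rpow_add_one (by positivity)]; simp
  have hA := haus_image_le (phi e) (prj u0) E (c := r * s0⁻¹) (d := (n:ℝ) - 1) (by positivity) hd
    (fun x hx y hy => by
      have := (key x hx y hy).1
      rw [norm_smul, Real.norm_of_nonneg (by positivity), ← mul_assoc, ← prj_sub] at this
      rwa [dist_eq_norm, dist_eq_norm])
  have hB := haus_image_le (prj u0) (phi e) E (c := r * s0) (d := (n:ℝ) - 1) (by positivity) hd
    (fun x hx y hy => by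
      have := (key x hx y hy).2
      rw [norm_smul, Real.norm_of_nonneg (by positivity), ← prj_sub] at this
      rw [dist_eq_norm, dist_eq_norm]
      calc _ = s0 * (s0⁻¹ * ‖prj u0 x - prj u0 y‖) := by field_simp
        _ ≤ s0 * (r * ‖phi e x - phi e y‖) := by gcongr
        _ = _ := by ring)
  rw [Real.mul_rpow (by positivity) (by positivity), ENNReal.ofReal_mul (by positivity)] at hA hB
  constructor
  · refine hA.trans ?_
    rw [hlin, ← hpow, ENNReal.ofReal_mul (by positivity), mul_assoc, ← mul_assoc (ENNReal.ofReal (s0⁻¹ ^ ((n:ℝ) - 1)))]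
    gcongr
  · rw [← hpow, ENNReal.ofReal_mul (by positivity), mul_assoc, ← hlin]
    calc _ ≤ ENNReal.ofReal (s0⁻¹ ^ ((n:ℝ) - 1)) * (ENNReal.ofReal (r ^ ((n:ℝ) - 1)) * ENNReal.ofReal (s0 ^ ((n:ℝ) - 1)) * μH[(n : ℝ) - 1] (phi e '' E)) := by gcongr
      _ = (ENNReal.ofReal (s0⁻¹ ^ ((n:ℝ) - 1)) * ENNReal.ofReal (s0 ^ ((n:ℝ) - 1))) * (ENNReal.ofReal (r ^ ((n:ℝ) - 1)) * μH[(n : ℝ) - 1] (phi e '' E)) := by ring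
      _ = ENNReal.ofReal (r ^ ((n:ℝ) - 1)) * μH[(n : ℝ) - 1] (phi e '' E) := by
        rw [← ENNReal.ofReal_mul (by positivity), ← Real.mul_rpow (by positivity) (by positivity), inv_mul_cancel₀ hs.ne']
        simp
      _ ≤ _ := by gcongr

lemma wt_local {X : Type*} [TopologicalSpace X] [MeasurableSpace X] (m : Measure X) {w : X → ℝ}
    (hw : Continuous w) (hpos : ∀ x, 0 < w x) (x0 : X) {c : ℝ} (hc : 1 < c) :
    ∃ U ∈ nhds x0, ∀ E, MeasurableSet E → E ⊆ U →
      ENNReal.ofReal (w x0) * m E ≤ ENNReal.ofReal c * ∫⁻ x in E, ENNReal.ofReal (w x) ∂m ∧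
      ∫⁻ x in E, ENNReal.ofReal (w x) ∂m ≤ ENNReal.ofReal c * (ENNReal.ofReal (w x0) * m E) := by
  have hc0 : 0 < c := by linarith
  refine ⟨{x | w x < c * w x0 ∧ w x0 < c * w x}, ?_, fun E hE hEU => ⟨?_, ?_⟩⟩
  · apply IsOpen.mem_nhds
    · exact (isOpen_lt hw continuous_const).inter (isOpen_lt continuous_const (continuous_const.mul hw))
    · have := hpos x0
      constructor <;> nlinarith
  · rw [← lintegral_const_mul' _ _ ENNReal.ofReal_ne_top, ← setLIntegral_const]
    refine setLIntegral_mono' hE fun x hx => ?_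
    rw [← ENNReal.ofReal_mul hc0.le]
    exact ENNReal.ofReal_le_ofReal (hEU hx).2.le
  · rw [← mul_assoc, ← setLIntegral_const]
    refine setLIntegral_mono' hE fun x hx => ?_
    rw [← ENNReal.ofReal_mul hc0.le]
    exact ENNReal.ofReal_le_ofReal (hEU hx).1.le

lemma face_local {n : ℕ} (hn : 2 ≤ n) {e y0 : EuclideanSpace ℝ (Fin n)} (he : ‖e‖ = 1)
    (hy0 : ⟪y0, e⟫ = 0) {c : ℝ} (hc : 1 < c) :
    ∃ U ∈ nhds y0, ∀ A : Set (EuclideanSpace ℝ (Fin n)),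
      (∀ x ∈ A, ∃ y ∈ U, ∀ z ∈ A, ⟪z, y + e⟫ ≤ ⟪x, y + e⟫) →
      μH[(n : ℝ) - 1] (prj e '' A) ≤ ENNReal.ofReal c *
        (ENNReal.ofReal ((sfac y0)⁻¹) * μH[(n : ℝ) - 1] A) ∧
      ENNReal.ofReal ((sfac y0)⁻¹) * μH[(n : ℝ) - 1] A ≤
        ENNReal.ofReal c * μH[(n : ℝ) - 1] (prj e '' A) := by
  have hd : (0:ℝ) ≤ (n:ℝ) - 1 := by
    have : (2:ℝ) ≤ n := by exact_mod_cast hn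
    linarith
  obtain ⟨r, hr, hrc⟩ := exists_rt hc (mul_nonneg zero_le_two hd)
  have hr0 : 0 < r := by linarith
  have hr1 : r⁻¹ < 1 := inv_lt_one_of_one_lt₀ hr
  have hs := sfac_pos y0
  have hs1 := one_le_sfac y0
  set s0 := sfac y0 with hs0
  set u0 := phi e y0 with hu0
  have hu0n : ‖u0‖ = 1 := phi_norm he hy0
  have hu0e : ⟪u0, e⟫ = s0⁻¹ := phi_inner he hy0
  have hsi : s0⁻¹ ≤ 1 := inv_le_one_of_one_le₀ hs1
  set κ := s0⁻¹ * r⁻¹ with hκ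
  have hκ0 : 0 < κ := by positivity
  have hκ1 : κ ≤ 1 := mul_le_one₀ hsi (by positivity) hr1.le
  set δ := κ * (1 - r⁻¹) with hδ
  have hδ0 : 0 < δ := mul_pos hκ0 (by linarith)
  refine ⟨Metric.ball y0 δ, Metric.ball_mem_nhds _ hδ0, fun A hA => ?_⟩
  have hin : ∀ x ∈ A, ∀ z ∈ A, ⟪x - z, u0⟫ ≤ δ * ‖x - z‖ := by
    intro x hx z hz
    obtain ⟨y, hy, hyz⟩ := hA z hz
    have h1 := hyz x hx
    have h2 : ⟪x - z, e + y0⟫ ≤ δ * ‖x - z‖ := by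
      calc ⟪x - z, e + y0⟫ = ⟪x - z, y + e⟫ + ⟪x - z, y0 - y⟫ := by
            rw [← inner_add_right]; congr 1; abel
        _ ≤ 0 + ‖x - z‖ * ‖y0 - y‖ := by
            gcongr
            · rw [inner_sub_left]; linarith
            · exact real_inner_le_norm _ _
        _ ≤ 0 + ‖x - z‖ * δ := by
            gcongr
            rw [← dist_eq_norm, dist_comm]; exact (Metric.mem_ball.1 hy).le
        _ = _ := by ring
    rw [hu0, phi_eq, inner_smul_right, ← hs0]
    calc s0⁻¹ * ⟪x - z, e + y0⟫ ≤ s0⁻¹ * (δ * ‖x - z‖) := by gcongr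
      _ ≤ 1 * (δ * ‖x - z‖) := by gcongr
      _ = _ := one_mul _
  have hab : ∀ x ∈ A, ∀ z ∈ A, |⟪x - z, u0⟫| ≤ δ * ‖x - z‖ := by
    intro x hx z hz
    rw [abs_le]
    refine ⟨?_, hin x hx z hz⟩
    have := hin z hz x hx
    rw [← neg_sub x z, inner_neg_left, norm_neg] at this
    linarith
  have k1 : ∀ x ∈ A, ∀ z ∈ A, ‖prj u0 (x - z)‖ ≤ r * ‖x - z‖ ∧ ‖x - z‖ ≤ r * ‖prj u0 (x - z)‖ := by
    intro x hx z hz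
    refine near_norm (δ := ‖x - z‖) (κ := 1) hr ?_ (by simp)
    rw [prj, sub_sub_cancel_left, norm_neg, norm_smul, hu0n, mul_one]
    refine (hab x hx z hz).trans ?_
    gcongr
    rw [hδ]; gcongr
  have k2 : ∀ x ∈ A, ∀ z ∈ A, ‖prj e (x - z)‖ ≤ r * ‖prj e (prj u0 (x - z))‖ ∧
      ‖prj e (prj u0 (x - z))‖ ≤ r * ‖prj e (x - z)‖ := by
    intro x hx z hz
    refine near_norm (δ := ‖x - z‖) (κ := κ) hr ?_ ?_
    · rw [prj_sub]
      refine (prj_norm_le he _).trans ?_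
      rw [prj, sub_sub_cancel, norm_smul, hu0n, mul_one]
      exact hab x hx z hz
    · have h1 := prj_lower hu0n he (prj_inner hu0n (x - z))
      rw [hu0e, abs_of_pos (by positivity)] at h1
      refine le_trans ?_ h1
      rw [hκ, mul_assoc]
      gcongr
      rw [inv_mul_le_iff₀ hr0]
      exact (k1 x hx z hz).2
  have hlin := haus_linear hn hu0n he (prj u0 '' A) (by
    rintro _ ⟨x, _, rfl⟩; exact prj_inner hu0n x)
  rw [hu0e, abs_of_pos (by positivity), Set.image_image] at hlin
  have a1 := haus_image_le (prj u0) (fun x => x) A (c := r) (d := (n:ℝ) - 1) hr0.le hd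
    (fun x hx y hy => by
      rw [dist_eq_norm, dist_eq_norm, prj_sub]; exact (k1 x hx y hy).1)
  have a2 := haus_image_le (fun x => x) (prj u0) A (c := r) (d := (n:ℝ) - 1) hr0.le hd
    (fun x hx y hy => by
      rw [dist_eq_norm, dist_eq_norm, prj_sub]; exact (k1 x hx y hy).2)
  have a3 := haus_image_le (prj e) (fun x => prj e (prj u0 x)) A (c := r) (d := (n:ℝ) - 1) hr0.le hd
    (fun x hx y hy => by
      rw [dist_eq_norm, dist_eq_norm, prj_sub, prj_sub, prj_sub]; exact (k2 x hx y hy).1)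
  have a4 := haus_image_le (fun x => prj e (prj u0 x)) (prj e) A (c := r) (d := (n:ℝ) - 1) hr0.le hd
    (fun x hx y hy => by
      rw [dist_eq_norm, dist_eq_norm, prj_sub, prj_sub, prj_sub]; exact (k2 x hx y hy).2)
  rw [Set.image_id'] at a1 a2
  have hCC : ENNReal.ofReal (r ^ ((n:ℝ) - 1)) * ENNReal.ofReal (r ^ ((n:ℝ) - 1)) ≤ ENNReal.ofReal c := by
    rw [← ENNReal.ofReal_mul (by positivity), ← Real.rpow_add hr0, ← two_mul]
    exact ENNReal.ofReal_le_ofReal hrc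
  set C := ENNReal.ofReal (r ^ ((n:ℝ) - 1))
  set k := ENNReal.ofReal s0⁻¹
  constructor
  · calc _ ≤ C * (k * μH[(n : ℝ) - 1] (prj u0 '' A)) := by rw [← hlin]; exact a3
      _ ≤ C * (k * (C * μH[(n : ℝ) - 1] A)) := by gcongr
      _ = (C * C) * (k * μH[(n : ℝ) - 1] A) := by ring
      _ ≤ _ := by gcongr
  · calc _ ≤ k * (C * μH[(n : ℝ) - 1] (prj u0 '' A)) := by gcongr
      _ = C * (k * μH[(n : ℝ) - 1] (prj u0 '' A)) := by ring
      _ ≤ C * (C * μH[(n : ℝ) - 1] (prj e '' A)) := by rw [← hlin]; gcongr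
      _ = (C * C) * μH[(n : ℝ) - 1] (prj e '' A) := by ring
      _ ≤ _ := by gcongr

lemma exists_half {c : ℝ} (hc : 1 < c) : ∃ r : ℝ, 1 < r ∧
    ENNReal.ofReal r * ENNReal.ofReal r = ENNReal.ofReal c := by
  refine ⟨Real.sqrt c, ?_, ?_⟩
  · rw [Real.lt_sqrt (by norm_num)]; linarith
  · rw [← ENNReal.ofReal_mul (Real.sqrt_nonneg _), Real.mul_self_sqrt (by linarith)]

lemma gno_area {n : ℕ} (hn : 2 ≤ n) {e : EuclideanSpace ℝ (Fin n)} (he : ‖e‖ = 1)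
    (E : Set (EuclideanSpace ℝ (Fin n))) (hE : MeasurableSet E) (hEe : E ⊆ {y | ⟪y, e⟫ = 0}) :
    μH[(n : ℝ) - 1] (phi e '' E) =
      ∫⁻ y in E, ENNReal.ofReal ((sfac y)⁻¹ ^ n) ∂μH[(n : ℝ) - 1] := by
  have hwc : Continuous fun y : EuclideanSpace ℝ (Fin n) => (sfac y)⁻¹ ^ n :=
    (sfac_cont.inv₀ fun y => (sfac_pos y).ne').pow n
  have hwp : ∀ y : EuclideanSpace ℝ (Fin n), 0 < (sfac y)⁻¹ ^ n := fun y => by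
    have := sfac_pos y
    positivity
  apply le_antisymm
  · refine local_le {y | ⟪y, e⟫ = 0} (fun _ => True) (fun E => μH[(n : ℝ) - 1] (phi e '' E))
      (fun E => ∫⁻ y in E, ENNReal.ofReal ((sfac y)⁻¹ ^ n) ∂μH[(n : ℝ) - 1]) ?_ ?_ (by simp) ?_ E hE hEe
    · intro E _ _ _
      simp only [image_iUnion]
      exact measure_iUnion_le _
    · intro E hm _ _ hdis
      exact (lintegral_iUnion hm hdis _).ge
    · intro y0 hy0 c hc
      obtain ⟨r, hr, hrc⟩ := exists_half hc
      obtain ⟨U1, hU1, h1⟩ := gno_local hn he hy0 hr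
      obtain ⟨U2, hU2, h2⟩ := wt_local (μH[(n : ℝ) - 1]) hwc hwp y0 hr
      refine ⟨U1 ∩ U2, Filter.inter_mem hU1 hU2, fun E hE hEU hEe => ⟨trivial, ?_⟩⟩
      have a := (h1 E (hEU.trans inter_subset_left) hEe).1
      have b := (h2 E hE (hEU.trans inter_subset_right)).1
      rw [← hrc, mul_assoc]
      exact a.trans (by gcongr)
  · refine local_le {y | ⟪y, e⟫ = 0} (fun _ => True)
      (fun E => ∫⁻ y in E, ENNReal.ofReal ((sfac y)⁻¹ ^ n) ∂μH[(n : ℝ) - 1])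
      (fun E => μH[(n : ℝ) - 1] (phi e '' E)) ?_ ?_ (by simp) ?_ E hE hEe
    · intro E hm _ hdis
      exact (lintegral_iUnion hm hdis _).le
    · intro E hm hD _ hdis
      simp only [image_iUnion]
      refine (measure_iUnion ?_ ?_).ge
      · intro i j hij
        rw [Function.onFun, Set.disjoint_left]
        rintro _ ⟨x, hx, rfl⟩ ⟨y, hy, hxy⟩
        have := phi_injOn he (hD j hy) (hD i hx) hxy
        subst this
        exact Set.disjoint_left.1 (hdis hij) hx hy
      · intro i
        exact (hm i).image_of_continuousOn_injOn (phi_cont e).continuousOn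
          ((phi_injOn he).mono (hD i))
    · intro y0 hy0 c hc
      obtain ⟨r, hr, hrc⟩ := exists_half hc
      obtain ⟨U1, hU1, h1⟩ := gno_local hn he hy0 hr
      obtain ⟨U2, hU2, h2⟩ := wt_local (μH[(n : ℝ) - 1]) hwc hwp y0 hr
      refine ⟨U1 ∩ U2, Filter.inter_mem hU1 hU2, fun E hE hEU hEe => ⟨trivial, ?_⟩⟩
      have a := (h1 E (hEU.trans inter_subset_left) hEe).2
      have b := (h2 E hE (hEU.trans inter_subset_right)).2
      rw [← hrc, mul_assoc]
      exact b.trans (by gcongr)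

lemma gno_lintegral {n : ℕ} (hn : 2 ≤ n) {e : EuclideanSpace ℝ (Fin n)} (he : ‖e‖ = 1)
    (E : Set (EuclideanSpace ℝ (Fin n))) (hE : MeasurableSet E) (hEe : E ⊆ {y | ⟪y, e⟫ = 0})
    {F : EuclideanSpace ℝ (Fin n) → ℝ≥0∞} (hF : Measurable F) :
    ∫⁻ u in phi e '' E, F u ∂μH[(n : ℝ) - 1] =
      ∫⁻ y in E, ENNReal.ofReal ((sfac y)⁻¹ ^ n) * F (phi e y) ∂μH[(n : ℝ) - 1] := by
  have hwc : Continuous fun y : EuclideanSpace ℝ (Fin n) => (sfac y)⁻¹ ^ n :=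
    (sfac_cont.inv₀ fun y => (sfac_pos y).ne').pow n
  have hwm : Measurable fun y : EuclideanSpace ℝ (Fin n) => ENNReal.ofReal ((sfac y)⁻¹ ^ n) :=
    hwc.measurable.ennreal_ofReal
  have hmeas : (μH[(n : ℝ) - 1]).restrict (phi e '' E) =
      Measure.map (phi e) (((μH[(n : ℝ) - 1]).restrict E).withDensity
        (fun y => ENNReal.ofReal ((sfac y)⁻¹ ^ n))) := by
    ext B hB
    have hB' : MeasurableSet (phi e ⁻¹' B) := (phi_cont e).measurable hB
    rw [Measure.restrict_apply hB, Measure.map_apply (phi_cont e).measurable hB,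
      withDensity_apply _ hB', Measure.restrict_restrict hB', ← gno_area hn he _ (hB'.inter hE)
        (inter_subset_right.trans hEe), Set.image_preimage_inter]
  have hFm : Measurable (fun y => F (phi e y)) := hF.comp (phi_cont e).measurable
  rw [hmeas, lintegral_map hF (phi_cont e).measurable,
    lintegral_withDensity_eq_lintegral_mul _ hwm hFm]
  rfl

section conv
variable {n : ℕ} {K : Set (EuclideanSpace ℝ (Fin n))}

lemma le_supp (hK : IsCompact K) {z : EuclideanSpace ℝ (Fin n)} (hz : z ∈ K)
    (u : EuclideanSpace ℝ (Fin n)) : ⟪z, u⟫ ≤ suppFn K u := by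
  rw [real_inner_comm]
  refine le_csSup ?_ ⟨z, hz, rfl⟩
  exact hK.bddAbove_image (by fun_prop)

lemma supp_le (hne : K.Nonempty) {u : EuclideanSpace ℝ (Fin n)} {b : ℝ}
    (h : ∀ z ∈ K, ⟪z, u⟫ ≤ b) : suppFn K u ≤ b := by
  refine csSup_le (hne.image _) ?_
  rintro _ ⟨z, hz, rfl⟩
  simpa only [real_inner_comm] using h z hz

lemma supp_cont (hK : IsCompact K) (hne : K.Nonempty) : Continuous (suppFn K) := by
  obtain ⟨R, hR⟩ := hK.isBounded.exists_norm_le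
  have : LipschitzWith (Real.toNNReal R) (suppFn K) := by
    refine LipschitzWith.of_le_add_mul' R fun u w => supp_le hne fun z hz => ?_
    have h1 := le_supp hK hz w
    have h2 : ⟪z, u - w⟫ ≤ R * dist u w := by
      rw [dist_eq_norm]
      exact (real_inner_le_norm _ _).trans (by gcongr; exact hR z hz)
    rw [inner_sub_right] at h2
    linarith
  exact this.continuous

lemma supp_smul_le (hK : IsCompact K) (hne : K.Nonempty) {c : ℝ} (hc : 0 < c)
    (u : EuclideanSpace ℝ (Fin n)) : suppFn K (c • u) ≤ c * suppFn K u := by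
  refine supp_le hne fun z hz => ?_
  rw [inner_smul_right]
  gcongr
  exact le_supp hK hz u

lemma supp_smul (hK : IsCompact K) (hne : K.Nonempty) {c : ℝ} (hc : 0 < c)
    (u : EuclideanSpace ℝ (Fin n)) : suppFn K (c • u) = c * suppFn K u := by
  apply le_antisymm (supp_smul_le hK hne hc u)
  have := supp_smul_le hK hne (inv_pos.2 hc) (c • u)
  rw [smul_smul, inv_mul_cancel₀ hc.ne', one_smul] at this
  rwa [← le_inv_mul_iff₀ hc]

lemma face_smul (hK : IsCompact K) (hne : K.Nonempty) {c : ℝ} (hc : 0 < c)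
    (u : EuclideanSpace ℝ (Fin n)) : face K (c • u) = face K u := by
  ext z
  simp only [face, mem_ofPred_eq, supp_smul hK hne hc, inner_smul_right,
    mul_right_inj' hc.ne']

lemma sg_eq (hK : IsCompact K) (hKc : Convex ℝ K) (hne : K.Nonempty)
    {e : EuclideanSpace ℝ (Fin n)} (he : ‖e‖ = 1) {y : EuclideanSpace ℝ (Fin n)}
    (hy : ⟪y, e⟫ = 0) :
    {z | ⟪z, e⟫ = 0 ∧ ∀ y', ⟪y', e⟫ = 0 →
      suppFn K (y + e) + ⟪z, y' - y⟫ ≤ suppFn K (y' + e)} = prj e '' face K (y + e) := by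
  have hee : ⟪e, e⟫ = (1:ℝ) := by rw [real_inner_self_eq_norm_sq, he]; norm_num
  ext z
  constructor
  · rintro ⟨hz, hsub⟩
    set t := suppFn K (y + e) - ⟪z, y⟫ with ht
    set x := z + t • e with hx
    have hey : ⟪e, y⟫ = 0 := by rw [real_inner_comm]; exact hy
    have hxv : ∀ y', ⟪y', e⟫ = 0 → ⟪x, y' + e⟫ = ⟪z, y'⟫ + t := by
      intro y' hy'
      have : ⟪e, y'⟫ = 0 := by rw [real_inner_comm]; exact hy'
      rw [hx, inner_add_left, inner_smul_left, inner_add_right, inner_add_right, hee, this, hz]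
      simp
    have hxy : ⟪x, y + e⟫ = suppFn K (y + e) := by rw [hxv y hy, ht]; ring
    have hray : ∃ s : ℝ, 0 ≤ s ∧ x + s • e ∈ K := by
      by_contra hcon
      push Not at hcon
      have hline : Continuous fun s : ℝ => x + s • e := by fun_prop
      let ray : Set (EuclideanSpace ℝ (Fin n)) := (fun s : ℝ => x + s • e) '' Ici 0
      have hiso : Isometry fun s : ℝ => x + s • e := by
        refine Isometry.of_dist_eq fun a b => ?_
        rw [dist_add_left, dist_eq_norm, ← sub_smul, norm_smul, he, mul_one, ← dist_eq_norm]
      have hcl : IsClosed ray := hiso.isClosedEmbedding.isClosedMap _ isClosed_Ici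
      have hcv : Convex ℝ ray := by
        rintro _ ⟨a, ha, rfl⟩ _ ⟨b, hb, rfl⟩ α β hα hβ hαβ
        refine ⟨α * a + β * b, ?_, ?_⟩
        · have ha' : (0:ℝ) ≤ a := ha
          have hb' : (0:ℝ) ≤ b := hb
          change (0:ℝ) ≤ α * a + β * b
          positivity
        · have : β = 1 - α := by linarith
          subst this
          simp only
          module
      have hdis : Disjoint K ray := by
        rw [Set.disjoint_left]
        rintro _ hk ⟨s, hs, rfl⟩
        exact hcon s hs hk
      obtain ⟨l, u1, v1, hl1, huv, hl2⟩ := geometric_hahn_banach_compact_closed hKc hK hcv hcl hdis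
      obtain ⟨R, hR⟩ := hK.isBounded.exists_norm_le
      obtain ⟨k0, hk0⟩ := hne
      have hR0 : 0 ≤ R := (norm_nonneg k0).trans (hR k0 hk0)
      set w := (InnerProductSpace.toDual ℝ (EuclideanSpace ℝ (Fin n))).symm l with hw
      have hlw : ∀ a, l a = ⟪w, a⟫ := fun a => by
        rw [hw, InnerProductSpace.toDual_symm_apply]
      have hle : 0 ≤ l e := by
        by_contra hneg
        push Not at hneg
        have h1 := hl2 (x + ((v1 - l x) / l e ⊔ 0) • e) ⟨_, mem_Ici.2 (le_max_right _ _), rfl⟩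
        rw [map_add, map_smul, smul_eq_mul] at h1
        have h2 : ((v1 - l x) / l e ⊔ 0) * l e ≤ (v1 - l x) / l e * l e :=
          mul_le_mul_of_nonpos_right (le_max_left _ _) hneg.le
        rw [div_mul_cancel₀ _ hneg.ne] at h2
        linarith
      have hlx : v1 < l x := hl2 x ⟨0, by simp, by simp⟩
      set M := R + ‖x‖ + 1 with hM
      have hM0 : 0 < M := by positivity
      set ε := (v1 - u1) / M with hε
      have hε0 : 0 < ε := div_pos (by linarith) hM0
      have hεM : ε * (R + ‖x‖) < v1 - u1 := by
        calc ε * (R + ‖x‖) < ε * M := by gcongr; linarith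
          _ = v1 - u1 := by rw [hε, div_mul_cancel₀ _ hM0.ne']
      set w' := w + ε • e with hw'
      set k := ⟪w', e⟫ with hk
      have hk0' : 0 < k := by
        rw [hk, hw', inner_add_left, inner_smul_left, hee, ← hlw]
        simp; linarith
      set y' := k⁻¹ • w' - e with hy'
      have hy'e : ⟪y', e⟫ = 0 := by
        rw [hy', inner_sub_left, inner_smul_left, hee, ← hk]
        simp [inv_mul_cancel₀ hk0'.ne']
      have h1 := hsub y' hy'e
      have h2 : ⟪x, y' + e⟫ ≤ suppFn K (y' + e) := by
        rw [hxv y' hy'e, ht]; rw [inner_sub_right] at h1; linarith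
      have h3 : y' + e = k⁻¹ • w' := by rw [hy']; abel
      rw [h3, supp_smul hK ⟨k0, hk0⟩ (inv_pos.2 hk0'), inner_smul_right] at h2
      have h4 : ⟪x, w'⟫ ≤ suppFn K w' := le_of_mul_le_mul_left h2 (inv_pos.2 hk0')
      have h5 : suppFn K w' ≤ u1 + ε * R := by
        refine supp_le ⟨k0, hk0⟩ fun a ha => ?_
        rw [hw', inner_add_right, inner_smul_right, real_inner_comm, ← hlw]
        have := hl1 a ha
        have h6 : ⟪a, e⟫ ≤ R := (real_inner_le_norm _ _).trans (by rw [he, mul_one]; exact hR a ha)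
        gcongr
      have h7 : v1 - ε * ‖x‖ < ⟪x, w'⟫ := by
        rw [hw', inner_add_right, inner_smul_right, real_inner_comm, ← hlw]
        have h6 : -‖x‖ ≤ ⟪x, e⟫ := by
          have := (abs_le.1 (abs_real_inner_le_norm x e)).1
          rwa [he, mul_one] at this
        nlinarith
      nlinarith
    obtain ⟨s, hs, hsK⟩ := hray
    have hs0 : s = 0 := by
      have h1 := le_supp hK hsK (y + e)
      rw [inner_add_left, hxy, inner_smul_left, inner_add_right, hey, hee] at h1
      simp at h1
      linarith
    rw [hs0, zero_smul, add_zero] at hsK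
    refine ⟨x, ⟨hsK, hxy⟩, ?_⟩
    rw [prj, hx, inner_add_left, inner_smul_left, hz, hee]
    simp
  · rintro ⟨x, ⟨hxK, hx⟩, rfl⟩
    refine ⟨prj_inner he x, fun y' hy' => ?_⟩
    have hz : ⟪e, y' - y⟫ = 0 := by
      rw [real_inner_comm, inner_sub_left, hy, hy', sub_zero]
    have h1 := le_supp hK hxK (y' + e)
    rw [← hx, prj, inner_sub_left, inner_smul_left, hz, mul_zero, sub_zero, ← inner_add_right]
    have : y + e + (y' - y) = y' + e := by abel
    rwa [this]

end conv


section core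
variable {n : ℕ} {K : Set (EuclideanSpace ℝ (Fin n))}

def AA (K : Set (EuclideanSpace ℝ (Fin n))) (e : EuclideanSpace ℝ (Fin n))
    (ω : Set (EuclideanSpace ℝ (Fin n))) : Set (EuclideanSpace ℝ (Fin n)) :=
  ⋃ y ∈ ω, face K (y + e)

lemma AA_mem {e x : EuclideanSpace ℝ (Fin n)} {ω : Set (EuclideanSpace ℝ (Fin n))} :
    x ∈ AA K e ω ↔ ∃ y ∈ ω, x ∈ K ∧ ⟪x, y + e⟫ = suppFn K (y + e) := by
  simp only [AA, mem_iUnion, exists_prop]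
  rfl

lemma AA_iUnion {ι : Type*} (e : EuclideanSpace ℝ (Fin n)) (E : ι → Set (EuclideanSpace ℝ (Fin n))) :
    AA K e (⋃ i, E i) = ⋃ i, AA K e (E i) := by
  ext x
  simp only [AA_mem, mem_iUnion]
  constructor
  · rintro ⟨y, ⟨i, hi⟩, h⟩; exact ⟨i, y, hi, h⟩
  · rintro ⟨i, y, hi, h⟩; exact ⟨y, ⟨i, hi⟩, h⟩

lemma AA_union (e : EuclideanSpace ℝ (Fin n)) (E F : Set (EuclideanSpace ℝ (Fin n))) :
    AA K e (E ∪ F) = AA K e E ∪ AA K e F := by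
  ext x
  simp only [AA_mem, mem_union]
  constructor
  · rintro ⟨y, h1 | h1, h⟩
    · exact Or.inl ⟨y, h1, h⟩
    · exact Or.inr ⟨y, h1, h⟩
  · rintro (⟨y, h1, h⟩ | ⟨y, h1, h⟩)
    · exact ⟨y, Or.inl h1, h⟩
    · exact ⟨y, Or.inr h1, h⟩

lemma AA_sub (e : EuclideanSpace ℝ (Fin n)) (E : Set (EuclideanSpace ℝ (Fin n))) :
    AA K e E ⊆ K := fun x hx => by
  obtain ⟨y, _, h, _⟩ := AA_mem.1 hx
  exact h

lemma AA_compact (hK : IsCompact K) (hne : K.Nonempty) (e : EuclideanSpace ℝ (Fin n))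
    {C : Set (EuclideanSpace ℝ (Fin n))} (hC : IsCompact C) : IsCompact (AA K e C) := by
  have hcl : IsClosed {q : EuclideanSpace ℝ (Fin n) × EuclideanSpace ℝ (Fin n) |
      ⟪q.2, q.1 + e⟫ = suppFn K (q.1 + e)} := by
    refine isClosed_eq (by fun_prop) ?_
    exact (supp_cont hK hne).comp (by fun_prop)
  have := ((hC.prod hK).inter_right hcl).image continuous_snd
  convert this using 1
  ext x
  rw [AA_mem]
  constructor
  · rintro ⟨y, hy, hx, h⟩
    exact ⟨(y, x), ⟨⟨hy, hx⟩, h⟩, rfl⟩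
  · rintro ⟨⟨y, x'⟩, ⟨⟨hy, hx⟩, h⟩, rfl⟩
    exact ⟨y, hy, hx, h⟩

lemma prj_cont (e : EuclideanSpace ℝ (Fin n)) : Continuous (prj e) := by
  unfold prj
  fun_prop

lemma prj_null (hn : 2 ≤ n) {e : EuclideanSpace ℝ (Fin n)} (he : ‖e‖ = 1)
    {A : Set (EuclideanSpace ℝ (Fin n))} (hA : μH[(n : ℝ) - 1] A = 0) :
    μH[(n : ℝ) - 1] (prj e '' A) = 0 := by
  have hd : (0:ℝ) ≤ (n:ℝ) - 1 := by
    have : (2:ℝ) ≤ n := by exact_mod_cast hn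
    linarith
  have := haus_image_le (prj e) id A zero_le_one hd (fun x _ y _ => by
    rw [dist_eq_norm, dist_eq_norm, one_mul, prj_sub]
    exact prj_norm_le he _)
  rw [image_id, hA, mul_zero] at this
  exact le_antisymm this bot_le

variable {e : EuclideanSpace ℝ (Fin n)} {D : Set (EuclideanSpace ℝ (Fin n))}
  {m : Measure (EuclideanSpace ℝ (Fin n))}

lemma AA_struct (hK : IsCompact K) (hne : K.Nonempty)
    (hmA : ∀ ω, MeasurableSet ω → ω ⊆ D → μH[(n : ℝ) - 1] (AA K e ω) = m ω)
    {E : Set (EuclideanSpace ℝ (Fin n))} (hE : MeasurableSet E) (hED : E ⊆ D) (hfin : m E ≠ ⊤) :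
    ∃ (P : ℕ → Set (EuclideanSpace ℝ (Fin n))) (N : Set (EuclideanSpace ℝ (Fin n))),
      (∀ k, IsCompact (P k)) ∧ μH[(n : ℝ) - 1] N = 0 ∧ AA K e E = (⋃ k, P k) ∪ N := by
  have : IsFiniteMeasure (m.restrict E) := ⟨by
    rw [Measure.restrict_apply_univ]; exact lt_top_iff_ne_top.2 hfin⟩
  have hex : ∀ k : ℕ, ∃ C, C ⊆ E ∧ IsCompact C ∧ (m.restrict E) (E \ C) < ((k : ℝ≥0∞) + 1)⁻¹ :=
    fun k => hE.exists_isCompact_sdiff_lt (measure_ne_top _ _) (by simp)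
  choose C hCE hC hlt using hex
  have hNm : MeasurableSet (E \ ⋃ k, C k) := hE.diff (MeasurableSet.iUnion fun k => (hC k).measurableSet)
  refine ⟨fun k => AA K e (C k), AA K e (E \ ⋃ k, C k), fun k => AA_compact hK hne e (hC k), ?_, ?_⟩
  · rw [hmA _ hNm (sdiff_subset.trans hED)]
    have h1 : ∀ k : ℕ, m (E \ ⋃ k, C k) ≤ ((k : ℝ≥0∞) + 1)⁻¹ := fun k => by
      refine le_trans ?_ (hlt k).le
      rw [Measure.restrict_apply (hE.diff (hC k).measurableSet)]
      refine measure_mono fun x hx => ⟨⟨hx.1, fun h => hx.2 (mem_iUnion.2 ⟨k, h⟩)⟩, hx.1⟩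
    by_contra h0
    obtain ⟨k, hk⟩ := ENNReal.exists_inv_nat_lt h0
    have h2 := h1 k
    have h3 : ((k : ℝ≥0∞) + 1)⁻¹ ≤ (k : ℝ≥0∞)⁻¹ := ENNReal.inv_le_inv.2 le_self_add
    exact absurd (h2.trans h3) (not_le.2 hk)
  · rw [← AA_iUnion, ← AA_union, union_sdiff_cancel (iUnion_subset hCE)]

lemma AA_nullMeas (hK : IsCompact K) (hne : K.Nonempty)
    (hmA : ∀ ω, MeasurableSet ω → ω ⊆ D → μH[(n : ℝ) - 1] (AA K e ω) = m ω)
    {E : Set (EuclideanSpace ℝ (Fin n))} (hE : MeasurableSet E) (hED : E ⊆ D) (hfin : m E ≠ ⊤) :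
    NullMeasurableSet (AA K e E) μH[(n : ℝ) - 1] := by
  obtain ⟨P, N, hP, hN, h⟩ := AA_struct hK hne hmA hE hED hfin
  rw [h]
  exact (MeasurableSet.iUnion fun k => (hP k).measurableSet).nullMeasurableSet.union
    (NullMeasurableSet.of_null hN)

lemma prjAA_nullMeas (hn : 2 ≤ n) (he : ‖e‖ = 1) (hK : IsCompact K) (hne : K.Nonempty)
    (hmA : ∀ ω, MeasurableSet ω → ω ⊆ D → μH[(n : ℝ) - 1] (AA K e ω) = m ω)
    {E : Set (EuclideanSpace ℝ (Fin n))} (hE : MeasurableSet E) (hED : E ⊆ D) (hfin : m E ≠ ⊤) :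
    NullMeasurableSet (prj e '' AA K e E) μH[(n : ℝ) - 1] := by
  obtain ⟨P, N, hP, hN, h⟩ := AA_struct hK hne hmA hE hED hfin
  rw [h, image_union, image_iUnion]
  exact (MeasurableSet.iUnion fun k =>
    ((hP k).image (prj_cont e)).measurableSet).nullMeasurableSet.union
    (NullMeasurableSet.of_null (prj_null hn he hN))

lemma AA_aedisj (hn : 2 ≤ n) (he : ‖e‖ = 1) (hK : IsCompact K) (hne : K.Nonempty)
    (hDe : D ⊆ {y | ⟪y, e⟫ = 0})
    (hmA : ∀ ω, MeasurableSet ω → ω ⊆ D → μH[(n : ℝ) - 1] (AA K e ω) = m ω)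
    {E F : Set (EuclideanSpace ℝ (Fin n))} (hE : MeasurableSet E) (hED : E ⊆ D) (hEfin : m E ≠ ⊤)
    (hF : MeasurableSet F) (hFD : F ⊆ D) (hFfin : m F ≠ ⊤) (hdis : Disjoint E F) :
    AEDisjoint μH[(n : ℝ) - 1] (prj e '' AA K e E) (prj e '' AA K e F) := by
  have hee : ⟪e, e⟫ = (1:ℝ) := by rw [real_inner_self_eq_norm_sq, he]; norm_num
  have h1 : μH[(n : ℝ) - 1] (AA K e E ∩ AA K e F) = 0 := by
    have h := measure_union_add_inter₀ (μ := μH[(n : ℝ) - 1]) (AA K e E)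
      (AA_nullMeas hK hne hmA hF hFD hFfin)
    rw [← AA_union, hmA _ (hE.union hF) (union_subset hED hFD), hmA _ hE hED, hmA _ hF hFD,
      measure_union hdis hF] at h
    have hfin : m E + m F ≠ ⊤ := ENNReal.add_ne_top.2 ⟨hEfin, hFfin⟩
    exact (ENNReal.add_right_inj hfin).1 (by rw [h, add_zero])
  refine measure_mono_null ?_ (prj_null hn he h1)
  rintro _ ⟨⟨x, hx, rfl⟩, ⟨x', hx', hxx⟩⟩
  have hxm := hx
  have hxm' := hx'
  obtain ⟨y, hy, hxK, hxy⟩ := AA_mem.1 hx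
  obtain ⟨y', hy', hxK', hxy'⟩ := AA_mem.1 hx'
  have h2 : x' = x + (⟪x', e⟫ - ⟪x, e⟫) • e := by
    unfold prj at hxx
    rw [sub_smul, ← sub_eq_zero]
    rw [← sub_eq_zero] at hxx
    rw [← hxx]; abel
  set s := ⟪x', e⟫ - ⟪x, e⟫ with hs
  have hye : ⟪e, y⟫ = 0 := by rw [real_inner_comm]; exact hDe (hED hy)
  have hye' : ⟪e, y'⟫ = 0 := by rw [real_inner_comm]; exact hDe (hFD hy')
  have h3 := le_supp hK hxK' (y + e)
  have h4 := le_supp hK hxK (y' + e)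
  rw [h2, inner_add_left, hxy, inner_smul_left, inner_add_right, hye, hee] at h3
  rw [← hxy', h2, inner_add_left, inner_smul_left, inner_add_right, inner_add_right,
    hye', hee] at h4
  simp at h3 h4
  have : s = 0 := le_antisymm h3 h4
  rw [this, zero_smul, add_zero] at h2
  subst h2
  exact ⟨x', ⟨hxm, hxm'⟩, rfl⟩

lemma core (hn : 2 ≤ n) (he : ‖e‖ = 1) (hK : IsCompact K) (hne : K.Nonempty)
    (hDe : D ⊆ {y | ⟪y, e⟫ = 0})
    (hmA : ∀ ω, MeasurableSet ω → ω ⊆ D → μH[(n : ℝ) - 1] (AA K e ω) = m ω)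
    {ω : Set (EuclideanSpace ℝ (Fin n))} (hω : MeasurableSet ω) (hωD : ω ⊆ D) :
    μH[(n : ℝ) - 1] (prj e '' AA K e ω) = ∫⁻ y in ω, ENNReal.ofReal (sfac y)⁻¹ ∂m := by
  have hwc : Continuous fun y : EuclideanSpace ℝ (Fin n) => (sfac y)⁻¹ :=
    sfac_cont.inv₀ fun y => (sfac_pos y).ne'
  have hwp : ∀ y : EuclideanSpace ℝ (Fin n), 0 < (sfac y)⁻¹ := fun y => inv_pos.2 (sfac_pos y)
  have hmax : ∀ U E : Set (EuclideanSpace ℝ (Fin n)), E ⊆ U →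
      ∀ x ∈ AA K e E, ∃ y ∈ U, ∀ z ∈ AA K e E, ⟪z, y + e⟫ ≤ ⟪x, y + e⟫ := by
    intro U E hEU x hx
    obtain ⟨y, hy, hxK, hxy⟩ := AA_mem.1 hx
    exact ⟨y, hEU hy, fun z hz => by rw [hxy]; exact le_supp hK (AA_sub e E hz) _⟩
  have hbd : ∀ E, μH[(n : ℝ) - 1] (prj e '' AA K e E) ≠ ⊤ := fun E => by
    refine haus_bounded hn he _ ?_ ?_
    · rintro _ ⟨x, _, rfl⟩
      exact prj_inner he x
    · exact ((hK.image (prj_cont e)).isBounded).subset (image_mono (AA_sub e E))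
  apply le_antisymm
  · refine local_le D (fun _ => True) (fun E => μH[(n : ℝ) - 1] (prj e '' AA K e E))
      (fun E => ∫⁻ y in E, ENNReal.ofReal (sfac y)⁻¹ ∂m) ?_ ?_ (by simp [AA]) ?_ ω hω hωD
    · intro E _ _ _
      simp only [AA_iUnion, image_iUnion]
      exact measure_iUnion_le _
    · intro E hm _ _ hdis
      exact (lintegral_iUnion hm hdis _).ge
    · intro y0 hy0 c hc
      obtain ⟨r, hr, hrc⟩ := exists_half hc
      obtain ⟨U1, hU1, h1⟩ := face_local hn he (hDe hy0) hr
      obtain ⟨U2, hU2, h2⟩ := wt_local m hwc hwp y0 hr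
      refine ⟨U1 ∩ U2, Filter.inter_mem hU1 hU2, fun E hE hEU hED => ⟨trivial, ?_⟩⟩
      have a := (h1 (AA K e E) (hmax _ _ (hEU.trans inter_subset_left))).1
      have b := (h2 E hE (hEU.trans inter_subset_right)).1
      rw [hmA E hE hED] at a
      rw [← hrc, mul_assoc]
      exact a.trans (by gcongr)
  · refine local_le D (fun E => m E ≠ ⊤)
      (fun E => ∫⁻ y in E, ENNReal.ofReal (sfac y)⁻¹ ∂m)
      (fun E => μH[(n : ℝ) - 1] (prj e '' AA K e E)) ?_ ?_ (by simp) ?_ ω hω hωD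
    · intro E hm _ hdis
      exact (lintegral_iUnion hm hdis _).le
    · intro E hm hD hfin hdis
      simp only [AA_iUnion, image_iUnion]
      refine (measure_iUnion₀ ?_ ?_).ge
      · intro i j hij
        exact AA_aedisj hn he hK hne hDe hmA (hm i) (hD i) (hfin i) (hm j) (hD j) (hfin j) (hdis hij)
      · intro i
        exact prjAA_nullMeas hn he hK hne hmA (hm i) (hD i) (hfin i)
    · intro y0 hy0 c hc
      obtain ⟨r, hr, hrc⟩ := exists_half hc
      obtain ⟨U1, hU1, h1⟩ := face_local hn he (hDe hy0) hr
      obtain ⟨U2, hU2, h2⟩ := wt_local m hwc hwp y0 hr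
      refine ⟨U1 ∩ U2, Filter.inter_mem hU1 hU2, fun E hE hEU hED => ?_⟩
      have a := (h1 (AA K e E) (hmax _ _ (hEU.trans inter_subset_left))).2
      have b := (h2 E hE (hEU.trans inter_subset_right)).2
      rw [hmA E hE hED] at a
      refine ⟨fun htop => ?_, ?_⟩
      · rw [htop, ENNReal.mul_top (ENNReal.ofReal_pos.2 (hwp y0)).ne'] at a
        exact ENNReal.mul_ne_top ENNReal.ofReal_ne_top (hbd E) (top_le_iff.1 a)
      · rw [← hrc, mul_assoc]
        exact b.trans (by gcongr)

end core

/-- **Lemma 3.1.** Transfer of the Monge–Ampère equation on `S^{n-1}` to the tangent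
hyperplane at `e`: the restriction `v(y) = h_K(y+e)` of the support function to `e + e^⊥`
satisfies `v^{1-p} det ∇²v = g` (in the sense of measure) on `e^⊥`, with
`g(y) = (1+‖y‖²)^{-(n+p)/2} f((e+y)/√(1+‖y‖²))`. -/
theorem stmt9 {n : ℕ} (hn : 2 ≤ n) {p : ℝ} (hp : p < 1)
    {e : EuclideanSpace ℝ (Fin n)} (he : e ∈ unitSphere n)
    {f : EuclideanSpace ℝ (Fin n) → ℝ} (hfm : Measurable f)
    (hfpos : ∀ u ∈ unitSphere n, 0 < f u)
    {K : Set (EuclideanSpace ℝ (Fin n))} (hK : IsConvexBody0 K)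
    (h0 : μH[(n : ℝ) - 1] {u ∈ unitSphere n | suppFn K u = 0} = 0)
    (hsol : ∀ ω : Set (EuclideanSpace ℝ (Fin n)), MeasurableSet ω →
      ω ⊆ {u ∈ unitSphere n | 0 < suppFn K u} →
      surfMeas K ω = ∫⁻ u in ω, ENNReal.ofReal (f u * suppFn K u ^ (p - 1)) ∂μH[(n : ℝ) - 1])
    (v : EuclideanSpace ℝ (Fin n) → ℝ) (hv : ∀ y, v y = suppFn K (y + e))
    (eperp : Set (EuclideanSpace ℝ (Fin n))) (heperp : eperp = {y | ⟪y, e⟫ = 0})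
    (sg : EuclideanSpace ℝ (Fin n) → Set (EuclideanSpace ℝ (Fin n)))
    (hsg : ∀ y, sg y = {z ∈ eperp | ∀ y' ∈ eperp, v y + ⟪z, y' - y⟫ ≤ v y'})
    (g : EuclideanSpace ℝ (Fin n) → ℝ)
    (hg : ∀ y, g y = (1 + ‖y‖ ^ 2) ^ (-((n : ℝ) + p) / 2) *
      f ((Real.sqrt (1 + ‖y‖ ^ 2))⁻¹ • (e + y))) :
    μH[(n : ℝ) - 1] {y ∈ eperp | v y = 0} = 0 ∧
    ∀ ω : Set (EuclideanSpace ℝ (Fin n)), MeasurableSet ω →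
      ω ⊆ {y ∈ eperp | 0 < v y} →
      μH[(n : ℝ) - 1] (⋃ y ∈ ω, sg y)
        = ∫⁻ y in ω, ENNReal.ofReal (g y * v y ^ (p - 1)) ∂μH[(n : ℝ) - 1] := by
  obtain ⟨hKc, hKcv, _, h0K⟩ := hK
  have hne : K.Nonempty := ⟨0, h0K⟩
  have he1 : ‖e‖ = 1 := by simpa [unitSphere] using he
  subst heperp
  have hsc := supp_cont hKc hne
  have hvc : Continuous v := by
    have : v = fun y => suppFn K (y + e) := funext hv
    rw [this]
    exact hsc.comp (by fun_prop)
  have hphiS : ∀ y, ⟪y, e⟫ = 0 → phi e y ∈ unitSphere n := fun y hy => by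
    simpa [unitSphere] using phi_norm he1 hy
  have hphi : ∀ y, phi e y = (sfac y)⁻¹ • (y + e) := fun y => by
    rw [add_comm y e]; rfl
  have hsupp : ∀ y, suppFn K (phi e y) = (sfac y)⁻¹ * v y := fun y => by
    rw [hphi, supp_smul hKc hne (inv_pos.2 (sfac_pos y)), hv]
  have hpc : IsClosed {y : EuclideanSpace ℝ (Fin n) | ⟪y, e⟫ = 0} :=
    isClosed_eq (by fun_prop) continuous_const
  constructor
  · set E := {y | y ∈ {y : EuclideanSpace ℝ (Fin n) | ⟪y, e⟫ = 0} ∧ v y = 0} with hEd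
    have hE : MeasurableSet E := (hpc.inter (isClosed_eq hvc continuous_const)).measurableSet
    have hEe : E ⊆ {y | ⟪y, e⟫ = 0} := fun y hy => hy.1
    have h1 : μH[(n : ℝ) - 1] (phi e '' E) = 0 := by
      refine measure_mono_null ?_ h0
      rintro _ ⟨y, hy, rfl⟩
      refine ⟨hphiS y hy.1, ?_⟩
      have h2 : v y = 0 := hy.2
      rw [hsupp, h2, mul_zero]
    rw [gno_area hn he1 E hE hEe] at h1
    have hwc : Continuous fun y : EuclideanSpace ℝ (Fin n) => (sfac y)⁻¹ ^ n :=
      (sfac_cont.inv₀ fun y => (sfac_pos y).ne').pow n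
    rw [lintegral_eq_zero_iff hwc.measurable.ennreal_ofReal] at h1
    have h2 : ∀ᵐ y ∂(μH[(n : ℝ) - 1]).restrict E, False := by
      filter_upwards [h1] with y hy
      have h3 : 0 < (sfac y)⁻¹ ^ n := pow_pos (inv_pos.2 (sfac_pos y)) n
      exact (ENNReal.ofReal_pos.2 h3).ne' hy
    have h4 : (μH[(n : ℝ) - 1]).restrict E = 0 := by
      rw [← ae_eq_bot]
      exact Filter.eventually_false_iff_eq_bot.1 h2
    exact Measure.restrict_eq_zero.1 h4
  · intro ω hω hωD
    set F : EuclideanSpace ℝ (Fin n) → ℝ≥0∞ :=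
      fun u => ENNReal.ofReal (f u * suppFn K u ^ (p - 1)) with hFd
    have hF : Measurable F :=
      (hfm.mul (hsc.measurable.pow_const (p - 1))).ennreal_ofReal
    set q : EuclideanSpace ℝ (Fin n) → ℝ≥0∞ :=
      fun y => ENNReal.ofReal ((sfac y)⁻¹ ^ n) * F (phi e y) with hqd
    have hsm : Measurable fun y : EuclideanSpace ℝ (Fin n) => (sfac y)⁻¹ :=
      (sfac_cont.inv₀ fun y => (sfac_pos y).ne').measurable
    have hq : Measurable q :=
      (hsm.pow_const n).ennreal_ofReal.mul (hF.comp (phi_cont e).measurable)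
    have hmA : ∀ ω, MeasurableSet ω → ω ⊆ {y | y ∈ {y : EuclideanSpace ℝ (Fin n) | ⟪y, e⟫ = 0} ∧ 0 < v y} →
        μH[(n : ℝ) - 1] (AA K e ω) = (μH[(n : ℝ) - 1]).withDensity q ω := by
      intro ω hω hωD
      have hωe : ω ⊆ {y | ⟪y, e⟫ = 0} := fun y hy => (hωD hy).1
      rw [withDensity_apply _ hω, ← gno_lintegral hn he1 ω hω hωe hF]
      have hm : MeasurableSet (phi e '' ω) :=
        hω.image_of_continuousOn_injOn (phi_cont e).continuousOn ((phi_injOn he1).mono hωe)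
      rw [← hsol _ hm ?_]
      · rw [surfMeas, biUnion_image]
        congr 1
        refine iUnion₂_congr fun y _ => ?_
        rw [hphi, face_smul hKc hne (inv_pos.2 (sfac_pos y))]
      · rintro _ ⟨y, hy, rfl⟩
        refine ⟨hphiS y (hωe hy), ?_⟩
        rw [hsupp]
        exact mul_pos (inv_pos.2 (sfac_pos y)) (hωD hy).2
    have hsgU : (⋃ y ∈ ω, sg y) = prj e '' AA K e ω := by
      rw [AA, image_iUnion₂]
      refine iUnion₂_congr fun y hy => ?_
      rw [hsg, ← sg_eq hKc hKcv hne he1 (hωD hy).1]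
      simp only [hv]
      rfl
    rw [hsgU, core hn he1 hKc hne (fun y hy => hy.1) hmA hω hωD, restrict_withDensity hω,
      lintegral_withDensity_eq_lintegral_mul _ hq hsm.ennreal_ofReal]
    refine setLIntegral_congr_fun hω fun y hy => ?_
    have hvy : 0 < v y := (hωD hy).2
    have hs := sfac_pos y
    have hfp := hfpos _ (hphiS y (hωD hy).1)
    have hsp : (0:ℝ) < ((sfac y)⁻¹ * v y) ^ (p - 1) := Real.rpow_pos_of_pos (by positivity) _
    simp only [Pi.mul_apply, hqd, hFd, hsupp]
    rw [← ENNReal.ofReal_mul (by positivity), ← ENNReal.ofReal_mul (by positivity)]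
    congr 1
    rw [hg, Real.mul_rpow (by positivity) hvy.le]
    have h5 : f ((Real.sqrt (1 + ‖y‖ ^ 2))⁻¹ • (e + y)) = f (phi e y) := rfl
    have h6 : (1 + ‖y‖ ^ 2) ^ (-((n : ℝ) + p) / 2) = (sfac y)⁻¹ ^ n * (sfac y)⁻¹ ^ (p - 1) * (sfac y)⁻¹ := by
      rw [← sfac_sq, ← Real.rpow_natCast (sfac y)⁻¹ n, ← Real.rpow_add (by positivity)]
      rw [← Real.rpow_add_one (by positivity), ← Real.rpow_natCast (sfac y) 2, ← Real.rpow_mul hs.le,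
        Real.inv_rpow hs.le, ← Real.rpow_neg hs.le]
      congr 1
      push_cast
      ring
    rw [h5, h6]
    ring
end
end

section
/- Let n ≥ 2, let Ω ⊆ ℝ^n be an open convex set, and let v be a nonnegative convex function defined on the closure of Ω such that S = {x ∈ Ω : v(x) = 0} is nonempty and compact, and v is locally strictly convex on Ω \ S (every point of Ω \ S has a convex open neighborhood on which v is strictly convex). Let ψ : (0,∞) → [0,∞) be nonincreasing and not identically zero, and let 0 < τ1 < τ2 be such that τ1 ∫_ω ψ(v(x)) dx ≤ μ_v(ω) ≤ τ2 ∫_ω ψ(v(x)) dx for every Borel set ω ⊆ Ω \ S. If the affine hull of S has dimension at most n − 1 and μ_v(S) = 0, then S is a single point. -/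
open MeasureTheory Set
open scoped ENNReal NNReal RealInnerProductSpace

noncomputable section

/-- Polar set of `G` with respect to `z`. -/
def polarAt {n : ℕ} (G : Set (EuclideanSpace ℝ (Fin n))) (z : EuclideanSpace ℝ (Fin n)) :
    Set (EuclideanSpace ℝ (Fin n)) :=
  {p | ∀ g ∈ G, ⟪p, g - z⟫ ≤ 1}

lemma polarAt_closed {n : ℕ} (G : Set (EuclideanSpace ℝ (Fin n)))
    (z : EuclideanSpace ℝ (Fin n)) : IsClosed (polarAt G z) := by
  have : polarAt G z = ⋂ g ∈ G, {p | ⟪p, g - z⟫ ≤ 1} := by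
    ext p; simp [polarAt]
  rw [this]
  refine isClosed_biInter fun g _ => isClosed_le (by fun_prop) continuous_const

lemma haus_haar (n : ℕ) :
    Measure.IsAddHaarMeasure (μH[(n : ℝ)] : Measure (EuclideanSpace ℝ (Fin n))) := by
  simpa using MeasureTheory.isAddHaarMeasure_hausdorffMeasure (E := EuclideanSpace ℝ (Fin n))

lemma haar_affine_preimage {n : ℕ} (μ : Measure (EuclideanSpace ℝ (Fin n)))
    [Measure.IsAddHaarMeasure μ] (r : ℝ) (hr : 0 < r) (c : EuclideanSpace ℝ (Fin n))
    (A : Set (EuclideanSpace ℝ (Fin n))) :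
    μ ((fun q => r • (q - c)) ⁻¹' A) = ENNReal.ofReal ((r ^ n)⁻¹) * μ A := by
  have h1 : (fun q => r • (q - c)) ⁻¹' A = (fun q => q + (-c)) ⁻¹' ((fun q => r • q) ⁻¹' A) := by
    ext q; simp [sub_eq_add_neg]
  rw [h1, measure_preimage_add_right, Measure.addHaar_preimage_smul μ hr.ne']
  simp [abs_of_pos hr]

lemma packing {n : ℕ} (μ : Measure (EuclideanSpace ℝ (Fin n)))
    [Measure.IsAddHaarMeasure μ] {G : Set (EuclideanSpace ℝ (Fin n))} (hG : Convex ℝ G)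
    {e x0 w z : EuclideanSpace ℝ (Fin n)} (hx0 : x0 ∈ G) (hw : w ∈ G)
    (hz : z = (1 / 2 : ℝ) • x0 + (1 / 2 : ℝ) • w) {δ : ℝ} (hδ : 0 < δ) {N : ℕ} (hN : 0 < N)
    (hew : ⟪e, w - x0⟫ = - (δ / 2)) (heG : ∀ g ∈ G, ⟪e, g - x0⟫ ≤ δ / (8 * N)) :
    N * (ENNReal.ofReal (((4 : ℝ) ^ n)⁻¹) * μ (polarAt G z)) ≤ μ (polarAt G x0) := by
  set B : ℕ → Set (EuclideanSpace ℝ (Fin n)) := fun k =>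
    (fun q => (4 : ℝ) • (q - (4 * k / δ) • e)) ⁻¹' polarAt G z with hB
  have hNR : (0 : ℝ) < N := by exact_mod_cast hN
  have hdec : ∀ k, ∀ q ∈ B k, ∃ p ∈ polarAt G z, q = (1 / 4 : ℝ) • p + (4 * k / δ) • e := by
    intro k q hq
    refine ⟨_, hq, ?_⟩
    simp only [smul_smul]
    norm_num
  have hpw : ∀ p ∈ polarAt G z, |⟪p, w - x0⟫| ≤ 2 := by
    intro p hp
    have h1 := hp w hw
    have h2 := hp x0 hx0
    have e1 : w - z = (1 / 2 : ℝ) • (w - x0) := by rw [hz]; module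
    have e2 : x0 - z = -(1 / 2 : ℝ) • (w - x0) := by rw [hz]; module
    rw [e1, inner_smul_right] at h1
    rw [e2, inner_smul_right] at h2
    rw [abs_le]; constructor <;> linarith
  have hval : ∀ k : ℕ, ∀ q ∈ B k, |⟪q, w - x0⟫ + 2 * k| ≤ 1 / 2 := by
    intro k q hq
    obtain ⟨p, hp, rfl⟩ := hdec k q hq
    have h := hpw p hp
    rw [inner_add_left, inner_smul_left, inner_smul_left, hew]
    have : (4 * (k : ℝ) / δ) * (-(δ / 2)) = - (2 * k) := by field_simp; ring
    simp only [conj_trivial]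
    rw [this]
    rw [abs_le] at h ⊢
    constructor <;> linarith
  have hsub : ∀ k < N, B k ⊆ polarAt G x0 := by
    intro k hk q hq g hg
    obtain ⟨p, hp, rfl⟩ := hdec k q hq
    have h1 := hp _ (hG hg hw (by norm_num : (0 : ℝ) ≤ 1 / 2) (by norm_num : (0 : ℝ) ≤ 1 / 2)
      (by norm_num))
    have e1 : (1 / 2 : ℝ) • g + (1 / 2 : ℝ) • w - z = (1 / 2 : ℝ) • (g - x0) := by
      rw [hz]; module
    rw [e1, inner_smul_right] at h1
    rw [inner_add_left, inner_smul_left, inner_smul_left]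
    simp only [conj_trivial]
    have hkN : (k : ℝ) ≤ N := by exact_mod_cast hk.le
    have h2 : (4 * (k : ℝ) / δ) * ⟪e, g - x0⟫ ≤ (4 * (k : ℝ) / δ) * (δ / (8 * N)) :=
      mul_le_mul_of_nonneg_left (heG g hg) (by positivity)
    have h3 : (4 * (k : ℝ) / δ) * (δ / (8 * N)) = k / N * (1 / 2) := by field_simp; ring
    have h4 : (k : ℝ) / N ≤ 1 := by rw [div_le_one hNR]; exact hkN
    rw [h3] at h2
    linarith
  have hdisj : (↑(Finset.range N) : Set ℕ).PairwiseDisjoint B := by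
    intro i _ j _ hij
    refine Set.disjoint_left.2 fun q hi hj => hij ?_
    have h1 := abs_le.1 (hval i q hi)
    have h2 := abs_le.1 (hval j q hj)
    have a1 : (i : ℝ) < j + 1 := by linarith
    have a2 : (j : ℝ) < i + 1 := by linarith
    have a1' : i < j + 1 := by exact_mod_cast a1
    have a2' : j < i + 1 := by exact_mod_cast a2
    omega
  have hmeas : ∀ k ∈ Finset.range N, MeasurableSet (B k) := by
    intro k _
    exact ((polarAt_closed G z).preimage (by fun_prop)).measurableSet
  have hun : μ (⋃ k ∈ Finset.range N, B k) ≤ μ (polarAt G x0) := by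
    refine measure_mono (iUnion₂_subset fun k hk => hsub k (Finset.mem_range.1 hk))
  rw [measure_biUnion_finset hdisj hmeas] at hun
  have : ∀ k ∈ Finset.range N, μ (B k) = ENNReal.ofReal (((4 : ℝ) ^ n)⁻¹) * μ (polarAt G z) := by
    intro k _
    exact haar_affine_preimage μ 4 (by norm_num) _ _
  rw [Finset.sum_congr rfl this] at hun
  simpa using hun

lemma polar_pos {n : ℕ} (μ : Measure (EuclideanSpace ℝ (Fin n)))
    [Measure.IsAddHaarMeasure μ] {G : Set (EuclideanSpace ℝ (Fin n))}
    (hG : Bornology.IsBounded G) (z : EuclideanSpace ℝ (Fin n)) : 0 < μ (polarAt G z) := by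
  obtain ⟨R, hR0, hR⟩ := hG.subset_ball_lt 0 z
  refine (Metric.measure_ball_pos μ 0 (inv_pos.2 hR0)).trans_le (measure_mono ?_)
  intro p hp g hg
  have h1 := hR hg
  rw [mem_ball_iff_norm] at h1
  rw [mem_ball_zero_iff] at hp
  refine (real_inner_le_norm _ _).trans ?_
  calc ‖p‖ * ‖g - z‖ ≤ R⁻¹ * R := by gcongr
    _ = 1 := inv_mul_cancel₀ hR0.ne'

lemma polar_fin {n : ℕ} (μ : Measure (EuclideanSpace ℝ (Fin n)))
    [Measure.IsAddHaarMeasure μ] {G : Set (EuclideanSpace ℝ (Fin n))}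
    (hG : IsOpen G) {z : EuclideanSpace ℝ (Fin n)} (hz : z ∈ G) : μ (polarAt G z) < ⊤ := by
  obtain ⟨r, hr0, hr⟩ := Metric.nhds_basis_closedBall.mem_iff.1 (hG.mem_nhds hz)
  suffices hsub : polarAt G z ⊆ Metric.closedBall 0 r⁻¹ from
    (measure_mono hsub).trans_lt measure_closedBall_lt_top
  intro p hp
  rw [mem_closedBall_zero_iff]
  rcases eq_or_ne p 0 with rfl | hp0
  · simp [hr0.le]
  have hpn : 0 < ‖p‖ := norm_pos_iff.2 hp0
  have h1 : z + (r / ‖p‖) • p ∈ G := by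
    apply hr
    rw [mem_closedBall_iff_norm]
    simp [norm_smul, abs_of_pos hr0, hpn.ne']
  have h2 := hp _ h1
  rw [add_sub_cancel_left, inner_smul_right, real_inner_self_eq_norm_sq] at h2
  have h3 : r / ‖p‖ * ‖p‖ ^ 2 = r * ‖p‖ := by field_simp
  rw [h3] at h2
  rw [le_inv_comm₀ hpn hr0, le_inv_comm₀ hr0 hpn, ← one_div, le_div_iff₀ hr0]
  linarith

/-- Sections near the zero set are localised. -/
lemma section_loc {n : ℕ} {Ω : Set (EuclideanSpace ℝ (Fin n))} (hΩo : IsOpen Ω)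
    {v : EuclideanSpace ℝ (Fin n) → ℝ} (hv : ConvexOn ℝ Ω v) (hvc : ContinuousOn v Ω)
    (hvnonneg : ∀ x ∈ Ω, 0 ≤ v x)
    {S : Set (EuclideanSpace ℝ (Fin n))} (hS : S = {x ∈ Ω | v x = 0}) (hScomp : IsCompact S)
    {x0 b e : EuclideanSpace ℝ (Fin n)} (hx0 : x0 ∈ S) (hb : 0 < ⟪e, x0 - b⟫)
    (hmax : ∀ x ∈ S, ⟪e, x⟫ ≤ ⟪e, x0⟫) {η : ℝ} (hη : 0 < η) :
    ∃ ε : ℝ, 0 < ε ∧ ∃ K : Set (EuclideanSpace ℝ (Fin n)), IsCompact K ∧ K ⊆ Ω ∧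
      {x ∈ Ω | v x < ε * ⟪e, x - b⟫} ⊆ K ∧ ∀ x ∈ K, ⟪e, x - x0⟫ ≤ η := by
  have hSΩ : S ⊆ Ω := by rw [hS]; exact fun x hx => hx.1
  obtain ⟨r1, hr1, hr1s⟩ := hScomp.exists_cthickening_subset_open hΩo hSΩ
  set r := min r1 (η / (‖e‖ + 1)) with hr
  have hr0 : 0 < r := by positivity
  have hKΩ : Metric.cthickening r S ⊆ Ω :=
    (Metric.cthickening_mono (min_le_left _ _) S).trans hr1s
  have hKc : IsCompact (Metric.cthickening r S) := hScomp.cthickening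
  have hne : S.Nonempty := ⟨x0, hx0⟩
  set F := {x | Metric.infDist x S = r} with hF
  have hFK : F ⊆ Metric.cthickening r S := by
    intro x hx
    exact Metric.mem_cthickening_of_dist_le _ _ _ _ (hScomp.exists_infDist_eq_dist hne x).choose_spec.1
      (by rw [← (hScomp.exists_infDist_eq_dist hne x).choose_spec.2]; exact hx.le)
  have hFc : IsCompact F :=
    hKc.of_isClosed_subset (isClosed_eq (Metric.continuous_infDist_pt S) continuous_const) hFK
  obtain ⟨c, hc0, hc⟩ : ∃ c > 0, ∀ x ∈ F, c ≤ v x := by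
    rcases F.eq_empty_or_nonempty with h | h
    · exact ⟨1, one_pos, by simp [h]⟩
    · obtain ⟨y, hy, hmin⟩ := hFc.exists_isMinOn h (hvc.mono (hFK.trans hKΩ))
      refine ⟨v y, ?_, fun x hx => hmin hx⟩
      refine (hvnonneg y (hKΩ (hFK hy))).lt_of_ne fun h0 => ?_
      have : y ∈ S := by rw [hS]; exact ⟨hKΩ (hFK hy), h0.symm⟩
      have h1 : Metric.infDist y S = 0 := Metric.infDist_zero_of_mem this
      have h2 : Metric.infDist y S = r := hy
      linarith
  obtain ⟨M, hM⟩ : ∃ M, ∀ x ∈ F, ⟪e, x - b⟫ ≤ M := by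
    obtain ⟨M, hM⟩ := (hFc.image (f := fun x => ⟪e, x - b⟫) (by fun_prop)).bddAbove
    exact ⟨M, fun x hx => hM ⟨x, hx, rfl⟩⟩
  refine ⟨c / (|M| + 1), by positivity, Metric.cthickening r S, hKc, hKΩ, ?_, ?_⟩
  · set ε := c / (|M| + 1) with hε
    have hε0 : 0 < ε := by positivity
    rintro x ⟨hxΩ, hxl⟩
    by_contra hx
    have hxr : r < Metric.infDist x S := by
      by_contra hcon
      obtain ⟨y, hy, hyd⟩ := hScomp.exists_infDist_eq_dist hne x
      exact hx (Metric.mem_cthickening_of_dist_le _ y _ _ hy (by rw [← hyd]; exact not_lt.1 hcon))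
    have hcont : ContinuousOn (fun t : ℝ => Metric.infDist (x0 + t • (x - x0)) S) (Icc 0 1) :=
      ((Metric.continuous_infDist_pt S).comp (by fun_prop)).continuousOn
    obtain ⟨t, ht, htr⟩ := intermediate_value_Icc zero_le_one hcont
      (show r ∈ Icc _ _ by
        constructor
        · simp [Metric.infDist_zero_of_mem hx0, hr0.le]
        · simp [hxr.le])
    set y := x0 + t • (x - x0) with hy
    have hyF : y ∈ F := htr
    have hv0 : v x0 = 0 := by rw [hS] at hx0; exact hx0.2
    have hyeq : y = (1 - t) • x0 + t • x := by rw [hy]; module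
    have h1 : v y ≤ (1 - t) * v x0 + t * v x := by
      rw [hyeq]
      exact hv.2 (hSΩ hx0) hxΩ (by linarith [ht.2]) ht.1 (by ring)
    have h2 : ⟪e, y - b⟫ = (1 - t) * ⟪e, x0 - b⟫ + t * ⟪e, x - b⟫ := by
      rw [← inner_smul_right, ← inner_smul_right, ← inner_add_right]
      congr 1; rw [hyeq]; module
    have h3 : v y ≤ ε * ⟪e, y - b⟫ := by
      rw [h2]
      have a1 : 0 ≤ (1 - t) * (ε * ⟪e, x0 - b⟫) :=
        mul_nonneg (by linarith [ht.2]) (by positivity)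
      have a2 : t * v x ≤ t * (ε * ⟪e, x - b⟫) := mul_le_mul_of_nonneg_left hxl.le ht.1
      rw [hv0] at h1
      linarith
    have h4 : ε * ⟪e, y - b⟫ ≤ ε * |M| :=
      mul_le_mul_of_nonneg_left ((hM y hyF).trans (le_abs_self M)) hε0.le
    have h5 : ε * (|M| + 1) = c := by rw [hε]; field_simp
    linarith [hc y hyF]
  · intro x hx
    rw [hScomp.cthickening_eq_biUnion_closedBall hr0.le] at hx
    simp only [mem_iUnion] at hx
    obtain ⟨y, hy, hxy⟩ := hx
    rw [mem_closedBall_iff_norm] at hxy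
    have h1 : ⟪e, x - x0⟫ = ⟪e, x - y⟫ + (⟪e, y⟫ - ⟪e, x0⟫) := by
      simp only [inner_sub_right]; ring
    have h2 : ⟪e, x - y⟫ ≤ ‖e‖ * r := (real_inner_le_norm _ _).trans (by gcongr)
    have h3 : ‖e‖ * r ≤ (‖e‖ + 1) * (η / (‖e‖ + 1)) := by
      gcongr
      · linarith
      · exact min_le_right _ _
    have h4 : (‖e‖ + 1) * (η / (‖e‖ + 1)) = η := by
      have : ‖e‖ + 1 ≠ 0 := by positivity
      field_simp
    linarith [hmax y hy]

/-- Aleksandrov-type lower inclusion. -/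
lemma lower_incl {n : ℕ} {Ω : Set (EuclideanSpace ℝ (Fin n))}
    {v : EuclideanSpace ℝ (Fin n) → ℝ} (hv : ConvexOn ℝ Ω v) (hvc : ContinuousOn v Ω)
    {x0 b e' : EuclideanSpace ℝ (Fin n)} (hx0 : x0 ∈ Ω) (hv0 : v x0 = 0)
    {K G : Set (EuclideanSpace ℝ (Fin n))} (hK : IsCompact K) (hKΩ : K ⊆ Ω)
    (hG : G = {x ∈ Ω | v x < ⟪e', x - b⟫}) (hGK : G ⊆ K) (hGo : IsOpen G)
    {d : ℝ} (hd : 0 < d) (hdx : ⟪e', x0 - b⟫ = d) :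
    (fun q => d⁻¹ • (q - e')) ⁻¹' polarAt G x0 ⊆ ⋃ x ∈ G, subgrad Ω v x := by
  intro q hq
  have hx0G : x0 ∈ G := by rw [hG]; exact ⟨hx0, by rw [hv0, hdx]; exact hd⟩
  have hcl : closure G ⊆ K := closure_minimal hGK hK.isClosed
  have hclc : IsCompact (closure G) := hK.of_isClosed_subset isClosed_closure hcl
  have hq1 : ∀ g ∈ closure G, ⟪q - e', g - x0⟫ ≤ d := by
    have : closure G ⊆ {g | ⟪q - e', g - x0⟫ ≤ d} := by
      refine closure_minimal ?_ (isClosed_le (by fun_prop) continuous_const)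
      intro g hg
      have := hq g hg
      rw [inner_smul_left] at this
      simp only [conj_trivial] at this
      rw [inv_mul_le_iff₀ hd] at this
      simpa using this
    exact this
  set h : EuclideanSpace ℝ (Fin n) → ℝ := fun x => v x - ⟪q, x⟫ with hh
  have hhc : ContinuousOn h Ω := hvc.sub (by fun_prop)
  have hhconv : ConvexOn ℝ Ω h := by
    refine hv.sub ⟨hv.1, ?_⟩
    intro x _ y _ a b _ _ _
    simp [inner_add_right, inner_smul_right]
  obtain ⟨y, hy, hmin⟩ := hclc.exists_isMinOn ⟨x0, subset_closure hx0G⟩ (hhc.mono (hcl.trans hKΩ))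
  have key : ∃ y ∈ G, IsMinOn h G y := by
    by_cases hyG : y ∈ G
    · exact ⟨y, hyG, hmin.on_subset subset_closure⟩
    · refine ⟨x0, hx0G, fun g hg => ?_⟩
      have h1 : h y ≤ h g := hmin (subset_closure hg)
      have h2 : ⟪e', y - b⟫ ≤ v y := by
        by_contra hcon
        exact hyG (by rw [hG]; exact ⟨hKΩ (hcl hy), not_le.1 hcon⟩)
      have h3 := hq1 y hy
      have h4 : h x0 ≤ h y := by
        simp only [hh, hv0]
        simp only [inner_sub_right, inner_sub_left] at h2 h3 hdx ⊢
        linarith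
      exact h4.trans h1
  obtain ⟨y, hyG, hymin⟩ := key
  have hyΩ : y ∈ Ω := hKΩ (hGK hyG)
  have hloc : IsLocalMinOn h Ω y := by
    have : IsLocalMin h y := hymin.isLocalMin (hGo.mem_nhds hyG)
    exact this.on Ω
  have hglob := IsMinOn.of_isLocalMinOn_of_convexOn hyΩ hloc hhconv
  simp only [mem_iUnion]
  refine ⟨y, hyG, fun x hx => ?_⟩
  have : h y ≤ h x := hglob hx
  simp only [hh] at this
  rw [inner_sub_right]
  linarith

/-- Upper inclusion. -/
lemma upper_incl {n : ℕ} {Ω : Set (EuclideanSpace ℝ (Fin n))}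
    {v : EuclideanSpace ℝ (Fin n) → ℝ} (hvnonneg : ∀ x ∈ Ω, 0 ≤ v x)
    {b z e' : EuclideanSpace ℝ (Fin n)}
    {G : Set (EuclideanSpace ℝ (Fin n))} (hGc : Convex ℝ G) (hz : z ∈ G)
    (hG : G = {x ∈ Ω | v x < ⟪e', x - b⟫})
    {d : ℝ} (hd : 0 < d) (hdx : ∀ x ∈ G, ⟪e', x - b⟫ ≤ 2 * d) :
    (⋃ x ∈ (fun y => (2 : ℝ) • (y - ((1 / 2 : ℝ) • z))) ⁻¹' G, subgrad Ω v x) ⊆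
      (fun q => (4 * d)⁻¹ • (q - e')) ⁻¹' polarAt G z := by
  intro q hq
  simp only [mem_iUnion] at hq
  obtain ⟨x, hx, hqx⟩ := hq
  intro g' hg'
  set g := (2 : ℝ) • (x - ((1 / 2 : ℝ) • z)) with hgdef
  have hgG : g ∈ G := hx
  have hxg : x = (1 / 2 : ℝ) • g + (1 / 2 : ℝ) • z := by rw [hgdef]; module
  have hxG : x ∈ G := by
    rw [hxg]; exact hGc hgG hz (by norm_num) (by norm_num) (by norm_num)
  have hyG : (1 / 2 : ℝ) • g + (1 / 2 : ℝ) • g' ∈ G :=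
    hGc hgG hg' (by norm_num) (by norm_num) (by norm_num)
  set y := (1 / 2 : ℝ) • g + (1 / 2 : ℝ) • g' with hydef
  have hyx : y - x = (1 / 2 : ℝ) • (g' - z) := by rw [hydef, hxg]; module
  have hyG2 := hyG
  have hxG2 := hxG
  rw [hG] at hyG2 hxG2
  have h1 := hqx y hyG2.1
  have h2 := hyG2.2
  have h3 := hdx x hxG
  have h4 := hvnonneg x hxG2.1
  have h5 : ⟪e', y - b⟫ = ⟪e', x - b⟫ + ⟪e', y - x⟫ := by
    simp only [inner_sub_right]; ring
  rw [h5] at h2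
  rw [hyx, inner_smul_right] at h1 h2
  rw [inner_smul_left]
  simp only [conj_trivial]
  rw [inv_mul_le_iff₀ (by positivity), inner_sub_left]
  linarith

/-- Doubling. -/
lemma doubling {n : ℕ} (μ : Measure (EuclideanSpace ℝ (Fin n)))
    [Measure.IsAddHaarMeasure μ] {G S : Set (EuclideanSpace ℝ (Fin n))}
    (hGm : MeasurableSet G) (hSm : MeasurableSet S) (hS0 : μ S = 0)
    (z : EuclideanSpace ℝ (Fin n)) (F : EuclideanSpace ℝ (Fin n) → ℝ≥0∞)
    (hF : ∀ x ∈ G \ S, (1 / 2 : ℝ) • x + (1 / 2 : ℝ) • z ∉ S →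
      F x ≤ F ((1 / 2 : ℝ) • x + (1 / 2 : ℝ) • z)) :
    ∫⁻ x in G \ S, F x ∂μ ≤ ENNReal.ofReal (2 ^ n) *
      ∫⁻ x in ((fun y => (2 : ℝ) • (y - ((1 / 2 : ℝ) • z))) ⁻¹' G) \ S, F x ∂μ := by
  set H := (fun y => (2 : ℝ) • (y - ((1 / 2 : ℝ) • z))) ⁻¹' G with hH
  have hHm : MeasurableSet H := hGm.preimage (by fun_prop)
  set h : EuclideanSpace ℝ (Fin n) → EuclideanSpace ℝ (Fin n) :=
    fun x => (1 / 2 : ℝ) • x + (1 / 2 : ℝ) • z with hh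
  have hpre : ∀ A : Set (EuclideanSpace ℝ (Fin n)), μ (h ⁻¹' A) = ENNReal.ofReal (2 ^ n) * μ A := by
    intro A
    have := haar_affine_preimage μ (1 / 2) (by norm_num) (-z) A
    have e : h = fun q => (1 / 2 : ℝ) • (q - -z) := by
      funext q; simp only [hh]; module
    rw [e, this]
    simp
  have hemb : MeasurableEmbedding h :=
    ((Homeomorph.smulOfNeZero (1 / 2 : ℝ) (by norm_num)).trans
      (Homeomorph.addRight ((1 / 2 : ℝ) • z))).measurableEmbedding
  have hmap : Measure.map h μ = ENNReal.ofReal (2 ^ n) • μ := by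
    ext A hA
    rw [hemb.map_apply, hpre]; simp
  have hHG : h ⁻¹' H = G := by
    ext x
    simp only [hH, hh, mem_preimage]
    have : (2 : ℝ) • ((1 / 2 : ℝ) • x + (1 / 2 : ℝ) • z - (1 / 2 : ℝ) • z) = x := by module
    rw [this]
  have e1 : ENNReal.ofReal (2 ^ n) * ∫⁻ x in H \ S, F x ∂μ = ∫⁻ x in G \ h ⁻¹' S, F (h x) ∂μ := by
    rw [← smul_eq_mul, ← lintegral_smul_measure, ← Measure.restrict_smul, ← hmap,
      hemb.restrict_map, hemb.lintegral_map, preimage_sdiff, hHG]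
  rw [e1]
  have hn0 : μ (h ⁻¹' S) = 0 := by rw [hpre, hS0, mul_zero]
  have hSm' : MeasurableSet (h ⁻¹' S) := hSm.preimage hemb.measurable
  have e2 : ∫⁻ x in G \ S, F x ∂μ = ∫⁻ x in (G \ S) \ h ⁻¹' S, F x ∂μ :=
    setLIntegral_congr (sdiff_null_ae_eq_self hn0).symm
  rw [e2]
  calc ∫⁻ x in (G \ S) \ h ⁻¹' S, F x ∂μ ≤ ∫⁻ x in (G \ S) \ h ⁻¹' S, F (h x) ∂μ :=
        setLIntegral_mono' ((hGm.diff hSm).diff hSm') fun x hx => hF x hx.1 hx.2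
    _ ≤ _ := lintegral_mono_set (sdiff_subset_sdiff_left sdiff_subset)

/-- **Proposition 3.4.** If the nonnegative convex function `v` on the closure of `Ω`
has nonempty compact zero set `S` of dimension at most `n-1`, `v` is locally strictly
convex on `Ω \ S`, `τ₁ ψ(v) ≤ det ∇²v ≤ τ₂ ψ(v)` in the sense of measure on `Ω \ S`
for a nonincreasing, not identically zero `ψ`, and `μ_v(S) = 0`, then `S` is a point. -/
theorem stmt12 {n : ℕ} (hn : 2 ≤ n) {Ω : Set (EuclideanSpace ℝ (Fin n))}
    (hΩo : IsOpen Ω) (hΩc : Convex ℝ Ω)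
    {v : EuclideanSpace ℝ (Fin n) → ℝ} (hvconv : ConvexOn ℝ (closure Ω) v)
    (hvnonneg : ∀ x ∈ closure Ω, 0 ≤ v x)
    (S : Set (EuclideanSpace ℝ (Fin n))) (hS : S = {x ∈ Ω | v x = 0})
    (hSne : S.Nonempty) (hScomp : IsCompact S)
    (hlsc : ∀ x ∈ Ω \ S, ∃ U : Set (EuclideanSpace ℝ (Fin n)),
      IsOpen U ∧ Convex ℝ U ∧ x ∈ U ∧ U ⊆ Ω ∧ StrictConvexOn ℝ U v)
    {ψ : ℝ → ℝ} (hψmono : ∀ s t : ℝ, 0 < s → s ≤ t → ψ t ≤ ψ s)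
    (hψnonneg : ∀ s : ℝ, 0 < s → 0 ≤ ψ s)
    (hψne : ∃ s : ℝ, 0 < s ∧ ψ s ≠ 0)
    {τ1 τ2 : ℝ} (hτ1 : 0 < τ1) (hτ12 : τ1 < τ2)
    (hma : ∀ ω : Set (EuclideanSpace ℝ (Fin n)), MeasurableSet ω → ω ⊆ Ω \ S →
      ENNReal.ofReal τ1 * ∫⁻ x in ω, ENNReal.ofReal (ψ (v x)) ∂μH[(n : ℝ)]
          ≤ maMeasure Ω v ω ∧
        maMeasure Ω v ω
          ≤ ENNReal.ofReal τ2 * ∫⁻ x in ω, ENNReal.ofReal (ψ (v x)) ∂μH[(n : ℝ)])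
    (hdim : Module.finrank ℝ (affineSpan ℝ S).direction ≤ n - 1)
    (hmaS : maMeasure Ω v S = 0) :
    ∃ x₀, S = {x₀} := by
  have hμ := haus_haar n
  set μ : Measure (EuclideanSpace ℝ (Fin n)) := μH[(n : ℝ)] with hμdef
  have hv : ConvexOn ℝ Ω v := hvconv.subset subset_closure hΩc
  have hvc : ContinuousOn v Ω := hv.continuousOn hΩo
  have hvn : ∀ x ∈ Ω, 0 ≤ v x := fun x hx => hvnonneg x (subset_closure hx)
  have hSΩ : S ⊆ Ω := by rw [hS]; exact fun x hx => hx.1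
  have hSv : ∀ x ∈ S, v x = 0 := by rw [hS]; exact fun x hx => hx.2
  have hS0 : μ S = 0 := by
    have hne : affineSpan ℝ S ≠ ⊤ := by
      intro h
      rw [h, AffineSubspace.direction_top, finrank_top] at hdim
      simp at hdim
      omega
    exact measure_mono_null (subset_affineSpan ℝ S) (Measure.addHaar_affineSubspace μ _ hne)
  have hSm : MeasurableSet S := hScomp.measurableSet
  by_contra hcon
  obtain ⟨b, hb⟩ := hSne
  obtain ⟨a, ha, hab⟩ : ∃ a ∈ S, a ≠ b := by
    by_contra h
    push Not at h
    exact hcon ⟨b, Subset.antisymm (fun x hx => h x hx) (by simpa using hb)⟩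
  set e := a - b with he
  obtain ⟨x0, hx0, hx0max⟩ := hScomp.exists_isMaxOn ⟨b, hb⟩
    (f := fun x => ⟪e, x⟫) (by fun_prop)
  have hmax : ∀ x ∈ S, ⟪e, x⟫ ≤ ⟪e, x0⟫ := fun x hx => hx0max hx
  obtain ⟨δ, hδ⟩ : ∃ δ, δ = ⟪e, x0 - b⟫ := ⟨_, rfl⟩
  have hδ0 : 0 < δ := by
    have h1 : 0 < ⟪e, a - b⟫ := by
      rw [← he, real_inner_self_eq_norm_sq]
      have : 0 < ‖e‖ := norm_pos_iff.2 (sub_ne_zero.2 hab)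
      positivity
    have h2 := hmax a ha
    rw [hδ]
    rw [inner_sub_right] at h1 ⊢
    linarith
  obtain ⟨N, hN⟩ := exists_nat_gt (τ2 / τ1 * 32 ^ n)
  have hτ2 : 0 < τ2 := hτ1.trans hτ12
  have hN0R : (0 : ℝ) < N := lt_trans (by positivity) hN
  have hN0 : 0 < N := by exact_mod_cast hN0R
  have hN1 : (1 : ℝ) ≤ N := by exact_mod_cast hN0
  obtain ⟨ε, hε, K, hKc, hKΩ, hGK, hKη⟩ := section_loc hΩo hv hvc hvn hS hScomp hx0
    (hδ ▸ hδ0) hmax (η := δ / (8 * N)) (by positivity)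
  obtain ⟨e', he'⟩ : ∃ e', e' = ε • e := ⟨_, rfl⟩
  have hin : ∀ x, ⟪e', x⟫ = ε * ⟪e, x⟫ := fun x => by
    rw [he', inner_smul_left]; simp
  obtain ⟨G, hG⟩ : ∃ G, G = {x ∈ Ω | v x < ⟪e', x - b⟫} := ⟨_, rfl⟩
  have hGK : G ⊆ K := by
    rw [hG]
    intro x hx
    exact hGK ⟨hx.1, by rw [← hin]; exact hx.2⟩
  have hGΩ : G ⊆ Ω := hGK.trans hKΩ
  have hGo : IsOpen G := by
    have h1 : ContinuousOn (fun x => v x - ⟪e', x - b⟫) Ω := hvc.sub (by fun_prop)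
    have h2 := h1.isOpen_inter_preimage hΩo (isOpen_Iio (a := (0 : ℝ)))
    convert h2 using 1
    rw [hG]; ext x; simp [sub_neg]
  have hGc : Convex ℝ G := by
    have h1 : ConvexOn ℝ Ω (fun x => v x - ⟪e', x - b⟫) := by
      refine hv.sub ⟨hv.1, ?_⟩
      intro x _ y _ s t _ _ hst
      simp only [smul_eq_mul]
      rw [← inner_smul_right, ← inner_smul_right, ← inner_add_right]
      apply le_of_eq
      congr 1
      have : b = (s + t) • b := by rw [hst, one_smul]
      conv_rhs => rw [this]
      module
    have h2 := h1.convex_lt 0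
    have h3 : G = {x ∈ Ω | v x - ⟪e', x - b⟫ < 0} := by
      rw [hG]; ext x; simp [sub_neg]
    rw [h3]; exact h2
  have hSconv : Convex ℝ S := by
    rw [hS]
    have h1 := hv.convex_le 0
    suffices h : {x ∈ Ω | v x = 0} = {x ∈ Ω | v x ≤ 0} by rw [h]; exact h1
    ext x
    constructor
    · rintro ⟨h, h'⟩; exact ⟨h, h'.le⟩
    · rintro ⟨h, h'⟩; exact ⟨h, le_antisymm h' (hvn x h)⟩
  set w := (1 / 2 : ℝ) • x0 + (1 / 2 : ℝ) • b with hw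
  set z := (1 / 2 : ℝ) • x0 + (1 / 2 : ℝ) • w with hz
  have hwS : w ∈ S := hSconv hx0 hb (by norm_num) (by norm_num) (by norm_num)
  have hzS : z ∈ S := hSconv hx0 hwS (by norm_num) (by norm_num) (by norm_num)
  obtain ⟨d, hd⟩ : ∃ d, d = ε * δ := ⟨_, rfl⟩
  have hd0 : 0 < d := by rw [hd]; positivity
  have hx0G : x0 ∈ G := by
    rw [hG]; refine ⟨hSΩ hx0, ?_⟩
    rw [hSv x0 hx0, hin, ← hδ]; positivity
  have hwG : w ∈ G := by
    rw [hG]; refine ⟨hSΩ hwS, ?_⟩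
    have : w - b = (1 / 2 : ℝ) • (x0 - b) := by rw [hw]; module
    rw [hSv w hwS, hin, this, inner_smul_right, ← hδ]; positivity
  have hzG : z ∈ G := hGc hx0G hwG (by norm_num) (by norm_num) (by norm_num)
  have hewx : ⟪e, w - x0⟫ = -(δ / 2) := by
    have : w - x0 = (-(1 / 2) : ℝ) • (x0 - b) := by rw [hw]; module
    rw [this, inner_smul_right, ← hδ]; ring
  have hpack := packing μ hGc hx0G hwG hz hδ0 hN0 hewx (fun g hg => hKη g (hGK hg))
  have hlow := lower_incl hv hvc (hSΩ hx0) (hSv x0 hx0) hKc hKΩ hG hGK hGo hd0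
    (by rw [hin, ← hδ, hd])
  have hupp := upper_incl hvn hGc hzG hG hd0 (by
    intro x hx
    have h1 := hKη x (hGK hx)
    have h2 : ⟪e, x - b⟫ = ⟪e, x - x0⟫ + δ := by
      rw [hδ]; simp only [inner_sub_right]; ring
    have h3 : δ / (8 * N) ≤ δ := div_le_self hδ0.le (by linarith)
    rw [hin, h2, hd]
    have : ε * (⟪e, x - x0⟫ + δ) ≤ ε * (δ + δ) :=
      mul_le_mul_of_nonneg_left (by linarith) hε.le
    linarith)
  set H := (fun y => (2 : ℝ) • (y - ((1 / 2 : ℝ) • z))) ⁻¹' G with hH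
  have hHG : H ⊆ G := by
    intro x hx
    have : x = (1 / 2 : ℝ) • ((2 : ℝ) • (x - ((1 / 2 : ℝ) • z))) + (1 / 2 : ℝ) • z := by module
    rw [this]
    exact hGc hx hzG (by norm_num) (by norm_num) (by norm_num)
  have hHm : MeasurableSet H := hGo.measurableSet.preimage (by fun_prop)
  have hdbl := doubling μ hGo.measurableSet hSm hS0 z (fun x => ENNReal.ofReal (ψ (v x))) (by
    intro x hx hxS
    apply ENNReal.ofReal_le_ofReal
    have hxΩ := hGΩ hx.1
    have hyΩ : (1 / 2 : ℝ) • x + (1 / 2 : ℝ) • z ∈ Ω :=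
      hΩc hxΩ (hSΩ hzS) (by norm_num) (by norm_num) (by norm_num)
    have h1 := hv.2 hxΩ (hSΩ hzS) (by norm_num : (0 : ℝ) ≤ 1 / 2) (by norm_num : (0 : ℝ) ≤ 1 / 2)
      (by norm_num)
    rw [hSv z hzS] at h1
    simp only [smul_eq_mul] at h1
    have h2 := hvn x hxΩ
    refine hψmono _ _ ?_ (by linarith)
    refine (hvn _ hyΩ).lt_of_ne fun h0 => hxS ?_
    rw [hS]; exact ⟨hyΩ, h0.symm⟩)
  obtain ⟨X, hX⟩ : ∃ X, X = μ (polarAt G z) := ⟨_, rfl⟩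
  have hX0 : X ≠ 0 := by
    rw [hX]; exact (polar_pos μ (hKc.isBounded.subset hGK) z).ne'
  have hXt : X ≠ ⊤ := by rw [hX]; exact (polar_fin μ hGo hzG).ne
  have c1 : ENNReal.ofReal (d ^ n) * μ (polarAt G x0) ≤ maMeasure Ω v G := by
    have h1 := measure_mono (μ := μ) hlow
    rw [haar_affine_preimage μ _ (inv_pos.2 hd0)] at h1
    simpa [maMeasure] using h1
  have c2 : maMeasure Ω v G ≤ maMeasure Ω v (G \ S) := by
    have h1 : (⋃ x ∈ G, subgrad Ω v x) ⊆ (⋃ x ∈ G \ S, subgrad Ω v x) ∪ ⋃ x ∈ S, subgrad Ω v x := by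
      rw [← biUnion_union]
      exact biUnion_mono (by intro x hx; by_cases h : x ∈ S <;> simp [h, hx]) fun _ _ => le_rfl
    have h2 := (measure_mono (μ := μ) h1).trans (measure_union_le _ _)
    have h3 : μ (⋃ x ∈ S, subgrad Ω v x) = 0 := hmaS
    rw [h3, add_zero] at h2
    exact h2
  have c3 := (hma (G \ S) (hGo.measurableSet.diff hSm) (fun x hx => ⟨hGΩ hx.1, hx.2⟩)).2
  have c4 := (hma (H \ S) (hHm.diff hSm) (fun x hx => ⟨hGΩ (hHG hx.1), hx.2⟩)).1
  have c5 : maMeasure Ω v (H \ S) ≤ ENNReal.ofReal ((4 * d) ^ n) * X := by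
    have h0 : (⋃ x ∈ H \ S, subgrad Ω v x) ⊆ ⋃ x ∈ H, subgrad Ω v x :=
      biUnion_mono (fun x hx => hx.1) fun _ _ => le_rfl
    have h1 := measure_mono (μ := μ) (h0.trans hupp)
    rw [haar_affine_preimage μ _ (inv_pos.2 (by positivity)), ← hX, inv_pow, inv_inv] at h1
    exact h1
  rw [← hX] at hpack
  have main : ENNReal.ofReal τ1 * (ENNReal.ofReal (d ^ n) *
      (N * (ENNReal.ofReal (((4 : ℝ) ^ n)⁻¹) * X))) ≤
      ENNReal.ofReal τ2 * (ENNReal.ofReal (2 ^ n) * (ENNReal.ofReal ((4 * d) ^ n) * X)) := by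
    calc _ ≤ ENNReal.ofReal τ1 * (ENNReal.ofReal (d ^ n) * μ (polarAt G x0)) := by gcongr
      _ ≤ ENNReal.ofReal τ1 * (ENNReal.ofReal τ2 * (ENNReal.ofReal (2 ^ n) *
          ∫⁻ x in H \ S, ENNReal.ofReal (ψ (v x)) ∂μ)) := by
          exact mul_le_mul_right ((c1.trans (c2.trans c3)).trans (mul_le_mul_right hdbl _)) _
      _ = ENNReal.ofReal τ2 * (ENNReal.ofReal (2 ^ n) * (ENNReal.ofReal τ1 *
          ∫⁻ x in H \ S, ENNReal.ofReal (ψ (v x)) ∂μ)) := by ring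
      _ ≤ _ := by
          exact mul_le_mul_right (mul_le_mul_right (c4.trans c5) _) _
  have hl : ENNReal.ofReal τ1 * (ENNReal.ofReal (d ^ n) *
      (N * (ENNReal.ofReal (((4 : ℝ) ^ n)⁻¹) * X))) =
      ENNReal.ofReal (τ1 * (d ^ n * (N * ((4 : ℝ) ^ n)⁻¹))) * X := by
    rw [ENNReal.ofReal_mul hτ1.le, ENNReal.ofReal_mul (by positivity),
      ENNReal.ofReal_mul (by positivity), ENNReal.ofReal_natCast]
    ring
  have hr : ENNReal.ofReal τ2 * (ENNReal.ofReal (2 ^ n) * (ENNReal.ofReal ((4 * d) ^ n) * X)) =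
      ENNReal.ofReal (τ2 * (2 ^ n * (4 * d) ^ n)) * X := by
    rw [ENNReal.ofReal_mul hτ2.le, ENNReal.ofReal_mul (by positivity)]
    ring
  rw [hl, hr, ENNReal.mul_le_mul_iff_left hX0 hXt, ENNReal.ofReal_le_ofReal_iff (by positivity)]
    at main
  have h32 : (32 : ℝ) ^ n = 2 ^ n * 4 ^ n * 4 ^ n := by
    rw [← mul_pow, ← mul_pow]; norm_num
  rw [div_mul_eq_mul_div, div_lt_iff₀ hτ1, h32] at hN
  have hdn : 0 < d ^ n := by positivity
  have h4n : (0 : ℝ) < 4 ^ n := by positivity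
  have hfin : τ1 * (d ^ n * (N * ((4 : ℝ) ^ n)⁻¹)) * 4 ^ n = (N * τ1) * d ^ n := by
    field_simp
  have hfin2 : τ2 * (2 ^ n * (4 * d) ^ n) * 4 ^ n = (τ2 * (2 ^ n * 4 ^ n * 4 ^ n)) * d ^ n := by
    rw [mul_pow]; ring
  have h5 := mul_le_mul_of_nonneg_right main h4n.le
  rw [hfin, hfin2] at h5
  have h6 := mul_lt_mul_of_pos_right hN hdn
  linarith
end
end

section
/- Let n ≥ 2, p ≤ 2 − n, and c > 0. Let K ∈ K_0^n and let μ be a Borel measure on S^{n-1} satisfying μ(ω) = H^{n-1}(⋃_{u∈ω} F(K,u)) for every Borel set ω ⊆ S^{n-1} (i.e. μ is the surface area measure S_K). If ∫_ω h_K(u)^{1−p} dμ(u) ≥ c·H^{n-1}(ω) for every Borel set ω ⊆ S^{n-1}, then o lies in the interior of K. -/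
open MeasureTheory Set
open scoped ENNReal NNReal RealInnerProductSpace

noncomputable section

theorem aux_proj {n : ℕ} (e : EuclideanSpace ℝ (Fin n)) (he : ‖e‖ = 1)
    (x : EuclideanSpace ℝ (Fin n)) :
    (((ℝ ∙ e)ᗮ.orthogonalProjectionOnto x : (ℝ ∙ e)ᗮ) : EuclideanSpace ℝ (Fin n))
      = x - ⟪e, x⟫ • e := by
  rw [← Submodule.starProjection_apply, Submodule.starProjection_orthogonal_val,
    Submodule.starProjection_unit_singleton ℝ he]

theorem aux_norm {n : ℕ} (e : EuclideanSpace ℝ (Fin n)) (he : ‖e‖ = 1)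
    (x : EuclideanSpace ℝ (Fin n)) :
    ‖(ℝ ∙ e)ᗮ.orthogonalProjectionOnto x‖ ^ 2 = ‖x‖ ^ 2 - ⟪e, x⟫ ^ 2 := by
  change ‖(((ℝ ∙ e)ᗮ.orthogonalProjectionOnto x : (ℝ ∙ e)ᗮ) : EuclideanSpace ℝ (Fin n))‖ ^ 2 = _
  rw [aux_proj e he, norm_sub_sq_real, inner_smul_right, norm_smul, he,
    real_inner_comm x e]
  simp
  ring

theorem aux_lower {m : ℕ} (hm : 1 ≤ m) (e : EuclideanSpace ℝ (Fin (m+1))) (he : ‖e‖ = 1)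
    {r : ℝ} (hr : 0 < r) (hr1 : r ≤ 1) :
    ENNReal.ofReal ((r/2) ^ m) * μH[(m : ℝ)] (Metric.ball (0 : (ℝ ∙ e)ᗮ) 1)
      ≤ μH[(m : ℝ)] ((unitSphere (m+1) ∩ Metric.ball e r) \ {e}) := by
  have he0 : e ≠ 0 := by rintro rfl; simp at he
  have : Fact (Module.finrank ℝ (EuclideanSpace ℝ (Fin (m+1))) = m + 1) := ⟨by simp⟩
  have hd : Module.finrank ℝ (ℝ ∙ e)ᗮ = m := Submodule.finrank_orthogonal_span_singleton he0
  have h1 := Measure.addHaar_ball_of_pos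
    (μH[(Module.finrank ℝ (ℝ ∙ e)ᗮ : ℝ)] : Measure (ℝ ∙ e)ᗮ) 0 (half_pos hr)
  rw [hd] at h1
  rw [← h1]
  have hm0 : (0:ℝ) < m := by exact_mod_cast hm
  have : NullSingletonClass (μH[(m : ℝ)] : Measure (ℝ ∙ e)ᗮ) := Measure.nullSingletonClass_hausdorff _ hm0
  rw [← measure_sdiff_null (s := Metric.ball (0 : (ℝ ∙ e)ᗮ) (r/2))
    (measure_singleton (0 : (ℝ ∙ e)ᗮ))]
  have hL : LipschitzWith 1 (ℝ ∙ e)ᗮ.orthogonalProjectionOnto := by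
    refine LipschitzWith.of_dist_le_mul fun x y => ?_
    rw [dist_eq_norm, dist_eq_norm, ← map_sub, NNReal.coe_one, one_mul]
    exact abs_le_of_sq_le_sq' (by rw [aux_norm e he]; nlinarith [sq_nonneg ⟪e, x - y⟫])
      (norm_nonneg _) |>.2
  have h2 := hL.hausdorffMeasure_image_le hm0.le
    ((unitSphere (m+1) ∩ Metric.ball e r) \ {e})
  simp only [ENNReal.coe_one, ENNReal.one_rpow, one_mul] at h2
  refine le_trans (measure_mono ?_) h2
  rintro w ⟨hw, hw0⟩
  rw [mem_ball_zero_iff] at hw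
  have hw0' : w ≠ 0 := by simpa using hw0
  have hwp : 0 < ‖w‖ := norm_pos_iff.2 hw0'
  have hwe : ⟪e, (w : EuclideanSpace ℝ (Fin (m+1)))⟫ = 0 :=
    Submodule.mem_orthogonal_singleton_iff_inner_right.1 w.2
  have hwe' : ⟪(w : EuclideanSpace ℝ (Fin (m+1))), e⟫ = 0 := by rw [real_inner_comm, hwe]
  have hee : ⟪e, e⟫ = (1:ℝ) := by rw [real_inner_self_eq_norm_sq, he]; norm_num
  set s := Real.sqrt (1 - ‖w‖^2) with hs
  have hs2 : s ^ 2 = 1 - ‖w‖^2 := Real.sq_sqrt (by nlinarith)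
  have hs0 : 0 ≤ s := Real.sqrt_nonneg _
  have hnw : ‖(w : EuclideanSpace ℝ (Fin (m+1)))‖ = ‖w‖ := rfl
  have key : ∀ t : ℝ, ‖(w : EuclideanSpace ℝ (Fin (m+1))) + t • e‖ ^ 2 = ‖w‖^2 + t^2 := by
    intro t
    rw [norm_add_sq_real, inner_smul_right, hwe', norm_smul, he, hnw]
    simp
  have hproj : (ℝ ∙ e)ᗮ.orthogonalProjectionOnto (w + s • e) = w := by
    apply Subtype.ext
    rw [aux_proj e he, inner_add_right, hwe, inner_smul_right, hee]
    simp
  refine ⟨w + s • e, ⟨⟨?_, ?_⟩, ?_⟩, hproj⟩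
  · have := key s
    rw [unitSphere, mem_sphere_zero_iff_norm]
    have h3 : ‖(w : EuclideanSpace ℝ (Fin (m+1))) + s • e‖ ^ 2 = 1 := by rw [this, hs2]; ring
    nlinarith [norm_nonneg ((w : EuclideanSpace ℝ (Fin (m+1))) + s • e)]
  · rw [mem_ball_iff_norm]
    have h3 : (w : EuclideanSpace ℝ (Fin (m+1))) + s • e - e = w + (s - 1) • e := by
      rw [sub_smul, one_smul]; abel
    rw [h3]
    refine lt_of_pow_lt_pow_left₀ 2 hr.le ?_
    rw [key]
    have : s ≤ 1 := by nlinarith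
    nlinarith
  · intro h
    rw [mem_singleton_iff] at h
    rw [h] at hproj
    apply hw0'
    rw [← hproj]
    apply Subtype.ext
    rw [aux_proj e he, hee]
    simp

theorem aux_bdd {n : ℕ} {K : Set (EuclideanSpace ℝ (Fin n))} {R : ℝ}
    (hR : ∀ y ∈ K, ‖y‖ ≤ R) (u : EuclideanSpace ℝ (Fin n)) :
    BddAbove ((fun y => ⟪u, y⟫) '' K) := by
  refine ⟨‖u‖ * R, ?_⟩
  rintro _ ⟨y, hy, rfl⟩
  exact (real_inner_le_norm u y).trans (by gcongr; exact hR y hy)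

theorem aux_finite {m : ℕ} (e : EuclideanSpace ℝ (Fin (m+1))) (he : ‖e‖ = 1)
    {K : Set (EuclideanSpace ℝ (Fin (m+1)))} {R : ℝ} (hR : ∀ y ∈ K, ‖y‖ ≤ R) :
    μH[(m : ℝ)] (⋃ u ∈ (unitSphere (m+1) ∩ Metric.ball e (1/2)) \ {e}, face K u) < ⊤ := by
  have he0 : e ≠ 0 := by rintro rfl; simp at he
  have : Fact (Module.finrank ℝ (EuclideanSpace ℝ (Fin (m+1))) = m + 1) := ⟨by simp⟩
  have hd : Module.finrank ℝ (ℝ ∙ e)ᗮ = m := Submodule.finrank_orthogonal_span_singleton he0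
  have hfin : μH[(m : ℝ)] (Metric.closedBall (0 : (ℝ ∙ e)ᗮ) R) < ⊤ := by
    have : (μH[(Module.finrank ℝ (ℝ ∙ e)ᗮ : ℝ)] : Measure (ℝ ∙ e)ᗮ) (Metric.closedBall 0 R) < ⊤ :=
      (isCompact_closedBall _ _).measure_lt_top
    rwa [hd] at this
  set X := ⋃ u ∈ (unitSphere (m+1) ∩ Metric.ball e (1/2)) \ {e}, face K u with hX
  set P := (ℝ ∙ e)ᗮ.orthogonalProjectionOnto
  have hone : ∀ z ∈ X, ∀ w ∈ X, ⟪e, w - z⟫ ≤ 1/2 * ‖w - z‖ := by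
    intro z hz w hw
    simp only [hX, mem_iUnion] at hz hw
    obtain ⟨u, ⟨⟨_, hu⟩, _⟩, hzK, hzu⟩ := hz
    obtain ⟨v, _, hwK, _⟩ := hw
    have h1 : ⟪u, w⟫ ≤ ⟪z, u⟫ := by
      rw [hzu]; exact le_csSup (aux_bdd hR u) ⟨w, hwK, rfl⟩
    rw [real_inner_comm] at h1
    have h2 : ⟪e, w - z⟫ = ⟪u, w - z⟫ + ⟪e - u, w - z⟫ := by
      rw [inner_sub_left]; ring
    have h3 : ⟪u, w - z⟫ ≤ 0 := by
      rw [inner_sub_right]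
      have := real_inner_comm u w
      have := real_inner_comm u z
      linarith
    have h4 := real_inner_le_norm (e - u) (w - z)
    have h5 : ‖e - u‖ ≤ 1/2 := by rw [norm_sub_rev]; exact (mem_ball_iff_norm.1 hu).le
    have := mul_le_mul_of_nonneg_right h5 (norm_nonneg (w - z))
    linarith
  have hanti : AntilipschitzWith 2 (fun x : X => P x) := by
    refine AntilipschitzWith.of_le_mul_dist fun x y => ?_
    rw [Subtype.dist_eq, dist_eq_norm, dist_eq_norm, ← map_sub]
    have h1 := hone x x.2 y y.2
    have h2 := hone y y.2 x x.2
    rw [← neg_sub, inner_neg_right, norm_neg] at h1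
    have h3 := aux_norm e he ((x : EuclideanSpace ℝ (Fin (m+1))) - y)
    refine abs_le_of_sq_le_sq' ?_ (by positivity) |>.2
    have h4 : ⟪e, (x : EuclideanSpace ℝ (Fin (m+1))) - y⟫ ^ 2
        ≤ (1/2 * ‖(x : EuclideanSpace ℝ (Fin (m+1))) - y‖)^2 := by
      apply sq_le_sq'
      · linarith
      · linarith
    rw [mul_pow, h3]
    norm_num
    nlinarith [sq_nonneg ‖(x : EuclideanSpace ℝ (Fin (m+1))) - y‖]
  have h1 := hanti.hausdorffMeasure_preimage_le (Nat.cast_nonneg m) (Metric.closedBall 0 R)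
  have h2 : (fun x : X => P x) ⁻¹' (Metric.closedBall 0 R) = univ := by
    ext x
    simp only [mem_preimage, mem_univ, iff_true, mem_closedBall_zero_iff]
    have hx := x.2
    simp only [hX, mem_iUnion] at hx
    obtain ⟨v, _, hxK, _⟩ := hx
    refine le_trans ?_ (hR x hxK)
    refine abs_le_of_sq_le_sq' ?_ (norm_nonneg _) |>.2
    rw [aux_norm e he]
    nlinarith [sq_nonneg ⟪e, (x : EuclideanSpace ℝ (Fin (m+1)))⟫]
  rw [h2] at h1
  have h3 := (isometry_subtype_coe (s := X)).hausdorffMeasure_image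
    (Or.inl (Nat.cast_nonneg m)) univ
  rw [image_univ, Subtype.range_coe] at h3
  rw [h3]
  refine h1.trans_lt (ENNReal.mul_lt_top ?_ hfin)
  exact ENNReal.rpow_lt_top_of_nonneg (Nat.cast_nonneg m) ENNReal.coe_ne_top

theorem aux_normal {n : ℕ} {K : Set (EuclideanSpace ℝ (Fin n))} (hK : IsConvexBody0 K)
    (h0 : (0 : EuclideanSpace ℝ (Fin n)) ∉ interior K) :
    ∃ e : EuclideanSpace ℝ (Fin n), ‖e‖ = 1 ∧ ∀ y ∈ K, ⟪e, y⟫ ≤ 0 := by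
  obtain ⟨hc, hconv, hint, -⟩ := hK
  obtain ⟨f, hf⟩ := geometric_hahn_banach_open_point hconv.interior isOpen_interior h0
  simp only [map_zero] at hf
  set v := (InnerProductSpace.toDual ℝ (EuclideanSpace ℝ (Fin n))).symm f with hv
  have hfv : ∀ y, ⟪v, y⟫ = f y := fun y => InnerProductSpace.toDual_symm_apply
  have hv0 : v ≠ 0 := by
    intro h
    obtain ⟨y, hy⟩ := hint
    have := hf y hy
    rw [← hfv, h, inner_zero_left] at this
    exact lt_irrefl _ this
  have hle : ∀ y ∈ K, f y ≤ 0 := by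
    have h1 : closure (interior K) ⊆ {y | f y ≤ 0} :=
      closure_minimal (fun y hy => (hf y hy).le) (isClosed_le f.continuous continuous_const)
    rw [hconv.closure_interior_eq_closure_of_nonempty_interior hint] at h1
    exact fun y hy => h1 (subset_closure hy)
  refine ⟨‖v‖⁻¹ • v, norm_smul_inv_norm hv0, fun y hy => ?_⟩
  rw [real_inner_smul_left, hfv]
  exact mul_nonpos_of_nonneg_of_nonpos (by positivity) (hle y hy)

/-- **Lemma 4.1.** For `p ≤ 2 - n`, if the `L_p` surface area measure of `K` dominates
`c · H^{n-1}` on Borel subsets of the sphere, then `o ∈ int K`. -/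
theorem stmt14 {n : ℕ} (hn : 2 ≤ n) {p : ℝ} (hp : p ≤ 2 - (n : ℝ)) {c : ℝ} (hc : 0 < c)
    {K : Set (EuclideanSpace ℝ (Fin n))} (hK : IsConvexBody0 K)
    (μ : Measure (EuclideanSpace ℝ (Fin n)))
    (hμ : ∀ ω : Set (EuclideanSpace ℝ (Fin n)), MeasurableSet ω → ω ⊆ unitSphere n →
      μ ω = surfMeas K ω)
    (hlb : ∀ ω : Set (EuclideanSpace ℝ (Fin n)), MeasurableSet ω → ω ⊆ unitSphere n →
      ENNReal.ofReal c * μH[(n : ℝ) - 1] ω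
        ≤ ∫⁻ u in ω, ENNReal.ofReal (suppFn K u ^ (1 - p)) ∂μ) :
    (0 : EuclideanSpace ℝ (Fin n)) ∈ interior K := by
  by_contra h0
  obtain ⟨e, he, hneg⟩ := aux_normal hK h0
  obtain ⟨hcomp, hconv, hint, hzero⟩ := hK
  obtain ⟨m, rfl⟩ : ∃ m, n = m + 1 := ⟨n - 1, by omega⟩
  have hm : 1 ≤ m := by omega
  have hdim : (((m + 1 : ℕ) : ℝ) - 1) = (m : ℝ) := by push_cast; ring
  obtain ⟨R, hRpos, hR⟩ : ∃ R : ℝ, 0 < R ∧ ∀ y ∈ K, ‖y‖ ≤ R := by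
    obtain ⟨R, hR⟩ := hcomp.isBounded.exists_norm_le
    exact ⟨max R 1, by positivity, fun y hy => (hR y hy).trans (le_max_left _ _)⟩
  simp only [surfMeas, hdim] at hμ hlb
  set ω : ℝ → Set (EuclideanSpace ℝ (Fin (m+1))) :=
    fun r => (unitSphere (m+1) ∩ Metric.ball e r) \ {e} with hω
  have hωm : ∀ r, MeasurableSet (ω r) := fun r =>
    ((Metric.isClosed_sphere.measurableSet).inter Metric.isOpen_ball.measurableSet).diff
      (measurableSet_singleton e)
  have hωs : ∀ r, ω r ⊆ unitSphere (m+1) := fun r x hx => hx.1.1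
  have hmono : Monotone ω := fun a b hab x hx =>
    ⟨⟨hx.1.1, Metric.ball_subset_ball hab hx.1.2⟩, hx.2⟩
  have hfin : μ (ω (1/2)) ≠ ⊤ := by
    rw [hμ _ (hωm _) (hωs _)]
    exact (aux_finite e he hR).ne
  have htend : Filter.Tendsto (fun k : ℕ => μ (ω (1 / ((k:ℝ) + 2)))) Filter.atTop (nhds 0) := by
    have hanti : Antitone (fun k : ℕ => ω (1 / ((k:ℝ) + 2))) := by
      intro a b hab
      apply hmono
      have : (a:ℝ) ≤ b := by exact_mod_cast hab
      gcongr
    have h1 := tendsto_measure_iInter_atTop (μ := μ)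
      (fun k : ℕ => (hωm (1 / ((k:ℝ) + 2))).nullMeasurableSet) hanti
      ⟨0, by simpa using hfin⟩
    have h2 : (⋂ k : ℕ, ω (1 / ((k:ℝ) + 2))) = ∅ := by
      rw [eq_empty_iff_forall_notMem]
      intro x hx
      rw [mem_iInter] at hx
      have hxe : x ≠ e := (hx 0).2
      have hd : 0 < dist x e := dist_pos.2 hxe
      obtain ⟨k, hk⟩ := exists_nat_one_div_lt hd
      have h3 : dist x e < 1 / ((k:ℝ) + 2) := (hx k).1.2
      have h4 : 1 / ((k:ℝ) + 2) ≤ 1 / ((k:ℝ) + 1) := by gcongr; norm_num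
      linarith
    rwa [h2, measure_empty] at h1
  set B := μH[(m : ℝ)] (Metric.ball (0 : (ℝ ∙ e)ᗮ) 1) with hB
  have hBpos : 0 < B := by
    have he0 : e ≠ 0 := by rintro rfl; simp at he
    have : Fact (Module.finrank ℝ (EuclideanSpace ℝ (Fin (m+1))) = m + 1) := ⟨by simp⟩
    have hd : Module.finrank ℝ (ℝ ∙ e)ᗮ = m := Submodule.finrank_orthogonal_span_singleton he0
    have : 0 < (μH[(Module.finrank ℝ (ℝ ∙ e)ᗮ : ℝ)] : Measure (ℝ ∙ e)ᗮ) (Metric.ball 0 1) :=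
      Metric.measure_ball_pos _ _ one_pos
    rwa [hd] at this
  have hq : (m : ℝ) ≤ 1 - p := by push_cast at hp; linarith
  have hq0 : 0 ≤ 1 - p := le_trans (Nat.cast_nonneg m) hq
  have hineq : ∀ r : ℝ, 0 < r → r ≤ 1 →
      ENNReal.ofReal c * (ENNReal.ofReal ((1/2) ^ m) * B)
        ≤ ENNReal.ofReal (R ^ (1 - p)) * μ (ω r) := by
    intro r hr hr1
    have h1 := hlb (ω r) (hωm r) (hωs r)
    have h2 := aux_lower hm e he hr hr1
    have h3 : ∫⁻ u in ω r, ENNReal.ofReal (suppFn K u ^ (1 - p)) ∂μ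
        ≤ ∫⁻ u in ω r, ENNReal.ofReal (R ^ (1 - p) * r ^ m) ∂μ := by
      refine setLIntegral_mono' (hωm r) fun u hu => ENNReal.ofReal_le_ofReal ?_
      have hs0 : 0 ≤ suppFn K u :=
        le_csSup (aux_bdd hR u) ⟨0, hzero, inner_zero_right _⟩
      have hs1 : suppFn K u ≤ R * r := by
        refine csSup_le ⟨_, 0, hzero, rfl⟩ ?_
        rintro _ ⟨y, hy, rfl⟩
        have h4 : ⟪u, y⟫ = ⟪u - e, y⟫ + ⟪e, y⟫ := by rw [inner_sub_left]; ring
        have h5 := real_inner_le_norm (u - e) y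
        have h6 : ‖u - e‖ ≤ r := (mem_ball_iff_norm.1 hu.1.2).le
        have h7 : ‖u - e‖ * ‖y‖ ≤ r * R := mul_le_mul h6 (hR y hy) (norm_nonneg _) hr.le
        have h8 := hneg y hy
        simp only
        linarith
      calc suppFn K u ^ (1 - p) ≤ (R * r) ^ (1 - p) := Real.rpow_le_rpow hs0 hs1 hq0
        _ = R ^ (1 - p) * r ^ (1 - p) := Real.mul_rpow hRpos.le hr.le
        _ ≤ R ^ (1 - p) * r ^ m := by
          gcongr
          rw [← Real.rpow_natCast]
          exact Real.rpow_le_rpow_of_exponent_ge hr hr1 hq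
    rw [setLIntegral_const] at h3
    have hrm : ENNReal.ofReal (r ^ m) ≠ 0 := by
      rw [Ne, ENNReal.ofReal_eq_zero, not_le]; positivity
    rw [← ENNReal.mul_le_mul_iff_right hrm ENNReal.ofReal_ne_top]
    calc ENNReal.ofReal (r ^ m) * (ENNReal.ofReal c * (ENNReal.ofReal ((1/2) ^ m) * B))
        = ENNReal.ofReal c * (ENNReal.ofReal ((r/2) ^ m) * B) := by
          have : (r/2)^m = r^m * (1/2)^m := by rw [← mul_pow]; ring
          rw [this, ENNReal.ofReal_mul (by positivity)]
          ring
      _ ≤ ENNReal.ofReal c * μH[(m : ℝ)] (ω r) := by gcongr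
      _ ≤ _ := h1.trans h3
      _ = ENNReal.ofReal (r ^ m) * (ENNReal.ofReal (R ^ (1 - p)) * μ (ω r)) := by
          rw [ENNReal.ofReal_mul (by positivity)]
          ring
  have hlim : Filter.Tendsto
      (fun k : ℕ => ENNReal.ofReal (R ^ (1 - p)) * μ (ω (1 / ((k:ℝ) + 2))))
      Filter.atTop (nhds 0) := by
    have := ENNReal.Tendsto.const_mul (a := ENNReal.ofReal (R ^ (1 - p))) htend
      (Or.inr ENNReal.ofReal_ne_top)
    simpa using this
  have hfinal := ge_of_tendsto' hlim (fun k => hineq (1 / ((k:ℝ) + 2)) (by positivity)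
    (by rw [div_le_one (by positivity)]; have : (0:ℝ) ≤ k := Nat.cast_nonneg k
        linarith))
  have hpos : 0 < ENNReal.ofReal c * (ENNReal.ofReal ((1/2) ^ m) * B) := by
    refine ENNReal.mul_pos (ENNReal.ofReal_pos.2 hc).ne' (ENNReal.mul_pos ?_ hBpos.ne').ne'
    exact (ENNReal.ofReal_pos.2 (by positivity)).ne'
  exact absurd hfinal (not_le.2 hpos)
end
end

section
/- Let n ≥ 2 and p > −n + 3. Let Ω = {(x₁, x₂) ∈ ℝ × ℝ^{n−1} : |x₁| < 1, ‖x₂‖ < 1} and S = {(x₁, x₂) ∈ Ω : x₂ = 0}. Then there exist a nonnegative convex function v on Ω and constants 0 < τ1 < τ2 such that {x ∈ Ω : v(x) = 0} = S, v is twice continuously differentiable on Ω \ S, and τ1 ≤ v(x)^{1−p} · det ∇²v(x) ≤ τ2 for every x ∈ Ω \ S, where ∇²v(x) is the Hessian matrix of v at x. -/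
open MeasureTheory Set
open scoped ENNReal NNReal RealInnerProductSpace

noncomputable section

/-- sum of squares off i0 -/
def sq15 {n : ℕ} (i0 : Fin n) (x : EuclideanSpace ℝ (Fin n)) : ℝ :=
  ∑ i ∈ Finset.univ.erase i0, x i ^ 2

def H15 {n : ℕ} (i0 : Fin n) (e f : ℝ) (x : EuclideanSpace ℝ (Fin n)) : ℝ :=
  (2 - x i0) ^ e * (sq15 i0 x) ^ f

lemma sq15_cd {n : ℕ} (i0 : Fin n) : ContDiff ℝ 2 (sq15 i0) := by
  unfold sq15; fun_prop

lemma sq15_hasFDeriv {n : ℕ} (i0 : Fin n) (x : EuclideanSpace ℝ (Fin n)) :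
    HasFDerivAt (sq15 i0) (∑ i ∈ Finset.univ.erase i0,
      (2 * x i) • (EuclideanSpace.proj i : EuclideanSpace ℝ (Fin n) →L[ℝ] ℝ)) x := by
  unfold sq15
  apply HasFDerivAt.fun_sum
  intro i _
  have := ((EuclideanSpace.proj i : EuclideanSpace ℝ (Fin n) →L[ℝ] ℝ).hasFDerivAt (x := x)).pow 2
  simpa using this

lemma H15_hasFDeriv {n : ℕ} (i0 : Fin n) (e f : ℝ) (x : EuclideanSpace ℝ (Fin n))
    (ht : 0 < 2 - x i0) (hs : 0 < sq15 i0 x) :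
    ∃ L : EuclideanSpace ℝ (Fin n) →L[ℝ] ℝ, HasFDerivAt (H15 i0 e f) L x ∧
      L (EuclideanSpace.single i0 1) = - e * H15 i0 (e-1) f x ∧
      ∀ j, j ≠ i0 → L (EuclideanSpace.single j 1) = 2 * f * x j * H15 i0 e (f-1) x := by
  have h1 := (((EuclideanSpace.proj i0 : EuclideanSpace ℝ (Fin n) →L[ℝ] ℝ).hasFDerivAt
    (x := x)).const_sub 2).rpow_const (p := e) (Or.inl ht.ne')
  have h2 := (sq15_hasFDeriv i0 x).rpow_const (p := f) (Or.inl hs.ne')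
  refine ⟨_, h1.mul h2, ?_, ?_⟩
  · simp [H15]
    ring
  · intro j hj
    simp [H15, hj.symm]
    ring

lemma H15_contDiffAt {n : ℕ} (i0 : Fin n) (e f : ℝ) (x : EuclideanSpace ℝ (Fin n))
    (ht : 0 < 2 - x i0) (hs : 0 < sq15 i0 x) : ContDiffAt ℝ 2 (H15 i0 e f) x := by
  unfold H15
  refine ContDiffAt.mul (ContDiffAt.rpow_const_of_ne ?_ ht.ne') 
    (ContDiffAt.rpow_const_of_ne (sq15_cd i0).contDiffAt hs.ne')
  fun_prop

lemma det15 {m : ℕ} (i0 : Fin (m+2)) (x : Fin (m+2) → ℝ) (D P B C : ℝ) (hD : D ≠ 0) (hP : P ≠ 0)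
    (M : Matrix (Fin (m+2)) (Fin (m+2)) ℝ)
    (h00 : M i0 i0 = D) (h0 : ∀ j, j ≠ i0 → M i0 j = C * x j)
    (h1 : ∀ i, i ≠ i0 → M i i0 = C * x i)
    (h2 : ∀ i j, i ≠ i0 → j ≠ i0 → M i j = (if i = j then P else 0) + B * (x i * x j)) :
    M.det = P ^ m * (D * (P + B * ∑ i ∈ Finset.univ.erase i0, x i ^ 2)
      - C ^ 2 * ∑ i ∈ Finset.univ.erase i0, x i ^ 2) := by
  let d : Fin (m+2) → ℝ := fun i => if i = i0 then D else P
  have hd : ∀ i, d i ≠ 0 := by intro i; simp only [d]; split_ifs <;> assumption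
  let y : Fin (m+2) → ℝ := fun i => if i = i0 then 0 else x i
  let z : Fin (m+2) → ℝ := fun i => if i = i0 then 1 else 0
  let U : Matrix (Fin (m+2)) (Fin 2) ℝ := Matrix.of fun i k => if k = 0 then z i else y i
  let V : Matrix (Fin 2) (Fin (m+2)) ℝ := 
    Matrix.of fun k i => if k = 0 then C * y i else C * z i + B * y i
  have hM : M = Matrix.diagonal d * (1 + (Matrix.diagonal (fun i => (d i)⁻¹) * U) * V) := by
    rw [Matrix.mul_add, ← Matrix.mul_assoc, ← Matrix.mul_assoc, Matrix.diagonal_mul_diagonal]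
    have : (fun i => d i * (d i)⁻¹) = fun _ => (1:ℝ) := by
      ext i; exact mul_inv_cancel₀ (hd i)
    rw [this, Matrix.diagonal_one, Matrix.one_mul, Matrix.mul_one]
    ext i j
    simp only [Matrix.add_apply, Matrix.mul_apply, Fin.sum_univ_two, U, V, Matrix.of_apply, 
      Matrix.diagonal_apply, y, z, d]
    by_cases hi : i = i0 <;> by_cases hj : j = i0
    · subst hi; subst hj; simp [h00]
    · subst hi; simp [h0 j hj, hj, Ne.symm hj]
    · subst hj; simp [h1 i hi, hi]; ring
    · simp [h2 i j hi hj, hi, hj]; ring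
  have hsum : ∀ g : Fin (m+2) → ℝ, ∑ i, g i = g i0 + ∑ i ∈ Finset.univ.erase i0, g i := by
    intro g; rw [Finset.add_sum_erase _ _ (Finset.mem_univ _)]
  have hdet : (Matrix.diagonal d).det = D * P ^ (m+1) := by
    rw [Matrix.det_diagonal, ← Finset.mul_prod_erase _ _ (Finset.mem_univ i0)]
    rw [Finset.prod_congr rfl (g := fun _ => P)]
    · simp [d]
    · intro i hi; simp [d, Finset.ne_of_mem_erase hi]
  rw [hM, Matrix.det_mul, Matrix.det_one_add_mul_comm, hdet, Matrix.det_fin_two]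
  set s := ∑ i ∈ Finset.univ.erase i0, x i ^ 2 with hs
  have hent : ∀ k l, (V * (Matrix.diagonal (fun i => (d i)⁻¹) * U)) k l
      = ∑ i, V k i * ((d i)⁻¹ * U i l) := by
    intro k l
    rw [Matrix.mul_apply]
    simp only [Matrix.diagonal_mul]
  have e00 : (V * (Matrix.diagonal (fun i => (d i)⁻¹) * U)) 0 0 = 0 := by
    rw [hent]
    refine Finset.sum_eq_zero fun i _ => ?_
    by_cases hi : i = i0 <;> simp [U, V, y, z, d, hi]
  have key : ∀ c : ℝ, ∑ i ∈ Finset.univ.erase i0, 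
      (if i = i0 then 0 else c * x i) * ((if i = i0 then D else P)⁻¹ * if i = i0 then 0 else x i) = c * s / P := by
    intro c
    rw [hs, Finset.mul_sum, Finset.sum_div]
    refine Finset.sum_congr rfl fun i hi => ?_
    simp [Finset.ne_of_mem_erase hi]; ring
  have e01 : (V * (Matrix.diagonal (fun i => (d i)⁻¹) * U)) 0 1 = C * s / P := by
    rw [hent, hsum, ← key C]
    simp [U, V, y, z, d]
  have e10 : (V * (Matrix.diagonal (fun i => (d i)⁻¹) * U)) 1 0 = C / D := by
    rw [hent, hsum, Finset.sum_eq_zero]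
    · simp [U, V, y, z, d]; ring
    · intro i hi; simp [U, V, y, z, d, Finset.ne_of_mem_erase hi]
  have e11 : (V * (Matrix.diagonal (fun i => (d i)⁻¹) * U)) 1 1 = B * s / P := by
    rw [hent, hsum, ← key B]
    have f0 : V 1 i0 * ((d i0)⁻¹ * U i0 1) = 0 := by simp [U, V, y, z, d]
    rw [f0, zero_add]
    refine Finset.sum_congr rfl fun i hi => ?_
    simp [U, V, y, z, d, Finset.ne_of_mem_erase hi]
  simp only [Matrix.add_apply, e00, e01, e10, e11]
  simp
  field_simp
  ring

def v15 {n : ℕ} (i0 : Fin n) (a b : ℝ) (x : EuclideanSpace ℝ (Fin n)) : ℝ :=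
  H15 i0 0 a x + H15 i0 (1 - 2 * b) b x

lemma dom15_open {n : ℕ} (i0 : Fin n) :
    IsOpen {x : EuclideanSpace ℝ (Fin n) | 0 < 2 - x i0 ∧ 0 < sq15 i0 x} := by
  have h1 : Continuous (sq15 i0) := (sq15_cd i0).continuous
  have h2 : Continuous (fun x : EuclideanSpace ℝ (Fin n) => 2 - x i0) := by fun_prop
  exact (isOpen_lt continuous_const h2).inter (isOpen_lt continuous_const h1)

lemma H15_fd0 {n : ℕ} (i0 : Fin n) (e f : ℝ) (x : EuclideanSpace ℝ (Fin n))
    (ht : 0 < 2 - x i0) (hs : 0 < sq15 i0 x) :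
    fderiv ℝ (H15 i0 e f) x (EuclideanSpace.single i0 1) = - e * H15 i0 (e-1) f x := by
  obtain ⟨L, hL, h, -⟩ := H15_hasFDeriv i0 e f x ht hs
  rw [hL.fderiv, h]

lemma H15_fdj {n : ℕ} (i0 : Fin n) (e f : ℝ) (x : EuclideanSpace ℝ (Fin n))
    (ht : 0 < 2 - x i0) (hs : 0 < sq15 i0 x) (j : Fin n) (hj : j ≠ i0) :
    fderiv ℝ (H15 i0 e f) x (EuclideanSpace.single j 1) = 2 * f * x j * H15 i0 e (f-1) x := by
  obtain ⟨L, hL, -, h⟩ := H15_hasFDeriv i0 e f x ht hs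
  rw [hL.fderiv, h j hj]

lemma H15_da {n : ℕ} (i0 : Fin n) (e f : ℝ) (x : EuclideanSpace ℝ (Fin n))
    (ht : 0 < 2 - x i0) (hs : 0 < sq15 i0 x) : DifferentiableAt ℝ (H15 i0 e f) x :=
  (H15_contDiffAt i0 e f x ht hs).differentiableAt (by norm_num)

lemma v15_fd0 {n : ℕ} (i0 : Fin n) (a b : ℝ) (x : EuclideanSpace ℝ (Fin n))
    (ht : 0 < 2 - x i0) (hs : 0 < sq15 i0 x) :
    fderiv ℝ (v15 i0 a b) x (EuclideanSpace.single i0 1) = (2*b-1) * H15 i0 (-(2*b)) b x := by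
  unfold v15
  rw [fderiv_fun_add (H15_da i0 _ _ x ht hs) (H15_da i0 _ _ x ht hs), add_apply,
    H15_fd0 _ _ _ _ ht hs, H15_fd0 _ _ _ _ ht hs]
  rw [show 1 - 2 * b - 1 = -(2*b) by ring]
  ring

lemma v15_fdj {n : ℕ} (i0 : Fin n) (a b : ℝ) (x : EuclideanSpace ℝ (Fin n))
    (ht : 0 < 2 - x i0) (hs : 0 < sq15 i0 x) (j : Fin n) (hj : j ≠ i0) :
    fderiv ℝ (v15 i0 a b) x (EuclideanSpace.single j 1) =
      x j * (2 * a * H15 i0 0 (a-1) x + 2 * b * H15 i0 (1-2*b) (b-1) x) := by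
  unfold v15
  rw [fderiv_fun_add (H15_da i0 _ _ x ht hs) (H15_da i0 _ _ x ht hs), add_apply,
    H15_fdj _ _ _ _ ht hs j hj, H15_fdj _ _ _ _ ht hs j hj]
  ring

lemma hess15_i0 {n : ℕ} (i0 : Fin n) (a b : ℝ) (x : EuclideanSpace ℝ (Fin n))
    (ht : 0 < 2 - x i0) (hs : 0 < sq15 i0 x) (i : Fin n) :
    hessMatrix (v15 i0 a b) x i i0 =
      fderiv ℝ (fun y => (2*b-1) * H15 i0 (-(2*b)) b y) x (EuclideanSpace.single i 1) := by
  unfold hessMatrix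
  rw [Matrix.of_apply, Filter.EventuallyEq.fderiv_eq]
  filter_upwards [(dom15_open i0).mem_nhds ⟨ht, hs⟩] with y hy
  exact v15_fd0 i0 a b y hy.1 hy.2

lemma hess15_ij {n : ℕ} (i0 : Fin n) (a b : ℝ) (x : EuclideanSpace ℝ (Fin n))
    (ht : 0 < 2 - x i0) (hs : 0 < sq15 i0 x) (i j : Fin n) (hj : j ≠ i0) :
    hessMatrix (v15 i0 a b) x i j =
      (if i = j then 1 else 0) * (2 * a * H15 i0 0 (a-1) x + 2 * b * H15 i0 (1-2*b) (b-1) x)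
      + x j * (2 * a * fderiv ℝ (H15 i0 0 (a-1)) x (EuclideanSpace.single i 1)
        + 2 * b * fderiv ℝ (H15 i0 (1-2*b) (b-1)) x (EuclideanSpace.single i 1)) := by
  unfold hessMatrix
  rw [Matrix.of_apply, Filter.EventuallyEq.fderiv_eq (f := fun y : EuclideanSpace ℝ (Fin n) =>
    y j * (2 * a * H15 i0 0 (a-1) y + 2 * b * H15 i0 (1-2*b) (b-1) y))]
  · have h0 := (EuclideanSpace.proj j : EuclideanSpace ℝ (Fin n) →L[ℝ] ℝ).hasFDerivAt (x := x)
    have h1 := (H15_da i0 0 (a-1) x ht hs).hasFDerivAt.const_mul (2*a)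
    have h2 := (H15_da i0 (1-2*b) (b-1) x ht hs).hasFDerivAt.const_mul (2*b)
    have h3 := h0.mul (h1.add h2)
    have h4 := h3.fderiv
    have h5 := congrArg (fun L => L (EuclideanSpace.single i (1:ℝ))) h4
    refine Eq.trans h5 ?_
    simp [eq_comm]
    by_cases hij : i = j
    · simp [hij]; ring
    · simp [hij]; ring
  · filter_upwards [(dom15_open i0).mem_nhds ⟨ht, hs⟩] with y hy
    exact v15_fdj i0 a b y hy.1 hy.2 j hj

lemma hess15_det {m : ℕ} (i0 : Fin (m+2)) (a b : ℝ) (ha : 1/2 < a) (hb : 1/2 < b)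
    (x : EuclideanSpace ℝ (Fin (m+2)))
    (ht : 0 < 2 - x i0) (hs : 0 < sq15 i0 x) :
    (hessMatrix (v15 i0 a b) x).det =
     (2 * a * sq15 i0 x ^ (a-1) + 2 * b * ((2 - x i0)^(1-2*b) * sq15 i0 x ^ (b-1)))^m *
     (2*a*(2*a-1)*(2*b)*(2*b-1) * ((2 - x i0)^(-(2*b)-1) * sq15 i0 x ^ (a+b-1))) := by
  set s := sq15 i0 x with hsd
  set t := 2 - x i0 with htd
  have hsum : ∑ i ∈ Finset.univ.erase i0, x i ^ 2 = s := rfl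
  have hs1 : ∀ c : ℝ, s ^ c = s ^ (c-1) * s := by
    intro c; rw [Real.rpow_sub_one hs.ne']; field_simp
  have ht1 : ∀ c : ℝ, t ^ c = t ^ (c-1) * t := by
    intro c; rw [Real.rpow_sub_one ht.ne']; field_simp
  have b0 : 0 < b := by linarith
  have a0 : 0 < a := by linarith
  have b1 : 0 < 2 * b - 1 := by linarith
  rw [det15 i0 x (2*b*(2*b-1) * (t^(-(2*b)-1) * s^b))
    (2 * a * s ^ (a-1) + 2 * b * (t^(1-2*b) * s ^ (b-1)))
    (4 * (a*(a-1)* s^(a-1-1) + b * (b-1) * (t^(1-2*b) * s^(b-1-1))))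
    (2*b*(2*b-1) * (t^(-(2*b)) * s^(b-1))) (by positivity) (by positivity)]
  · rw [hsum]
    congr 1
    have e1 : s ^ (a+b-1) = s ^(a-1-1) * s^(b-1-1) * s * s * s:= by
      rw [← Real.rpow_add hs, ← Real.rpow_add_one hs.ne', ← Real.rpow_add_one hs.ne', 
        ← Real.rpow_add_one hs.ne']
      congr 1; ring
    have e2 : t ^ (1-2*b) = t ^ (-(2*b)-1) * t * t := by
      rw [← Real.rpow_add_one ht.ne', ← Real.rpow_add_one ht.ne']
      congr 1; ring
    rw [e1, e2, hs1 b, hs1 (a-1), hs1 (b-1), ht1 (-(2*b))]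
    ring
  · rw [hess15_i0 _ _ _ _ ht hs, fderiv_const_mul (H15_da _ _ _ _ ht hs)]
    simp only [smul_apply, smul_eq_mul]
    rw [H15_fd0 _ _ _ _ ht hs]
    simp only [H15, ← hsd, ← htd]
    ring
  · intro j hj
    rw [hess15_ij _ _ _ _ ht hs _ _ hj, H15_fd0 _ _ _ _ ht hs, H15_fd0 _ _ _ _ ht hs]
    rw [if_neg hj.symm]
    simp only [H15, ← hsd, ← htd]
    rw [show 1 - 2 * b - 1 = -(2*b) by ring]
    ring
  · intro i hi
    rw [hess15_i0 _ _ _ _ ht hs, fderiv_const_mul (H15_da _ _ _ _ ht hs)]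
    simp only [smul_apply, smul_eq_mul]
    rw [H15_fdj _ _ _ _ ht hs _ hi]
    simp only [H15, ← hsd, ← htd]
    ring
  · intro i j hi hj
    rw [hess15_ij _ _ _ _ ht hs _ _ hj, H15_fdj _ _ _ _ ht hs _ hi, H15_fdj _ _ _ _ ht hs _ hi]
    simp only [H15, ← hsd, ← htd, Real.rpow_zero]
    split_ifs <;> ring

lemma sqrt15_conv {n : ℕ} (i0 : Fin n) (x y : EuclideanSpace ℝ (Fin n)) (c d : ℝ)
    (hc : 0 ≤ c) (hd : 0 ≤ d) :
    √(sq15 i0 (c • x + d • y)) ≤ c * √(sq15 i0 x) + d * √(sq15 i0 y) := by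
  let P : EuclideanSpace ℝ (Fin n) → EuclideanSpace ℝ (Fin n) := 
    fun x => WithLp.toLp 2 (fun i => if i = i0 then 0 else x i)
  have hP : ∀ x, √(sq15 i0 x) = ‖P x‖ := by
    intro x
    rw [EuclideanSpace.norm_eq, ← Finset.add_sum_erase _ _ (Finset.mem_univ i0)]
    simp only [P, sq15, if_true]
    rw [norm_zero, zero_pow two_ne_zero, zero_add]
    congr 1
    refine Finset.sum_congr rfl fun i hi => ?_
    simp [Finset.ne_of_mem_erase hi]
  have hl : P (c • x + d • y) = c • P x + d • P y := by
    ext i; by_cases hi : i = i0 <;> simp [P, hi]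
  rw [hP, hP, hP, hl]
  refine (norm_add_le _ _).trans ?_
  rw [norm_smul, norm_smul, Real.norm_of_nonneg hc, Real.norm_of_nonneg hd]

lemma persp15 (β : ℝ) (hβ : 1 ≤ β) (r1 r2 t1 t2 c d : ℝ) (hr1 : 0 ≤ r1) (hr2 : 0 ≤ r2)
    (ht1 : 0 < t1) (ht2 : 0 < t2) (hc : 0 ≤ c) (hd : 0 ≤ d) (hcd : c + d = 1) :
    (c * t1 + d * t2) * ((c * r1 + d * r2) / (c * t1 + d * t2)) ^ β ≤
      c * (t1 * (r1 / t1) ^ β) + d * (t2 * (r2/t2) ^ β) := by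
  have hT : 0 < c * t1 + d * t2 := by
    rcases hc.eq_or_lt with h | h
    · have : d = 1 := by linarith
      subst this; subst h; linarith
    · nlinarith [mul_pos h ht1, mul_nonneg hd ht2.le]
  set T := c * t1 + d * t2 with hTd
  have h := (convexOn_rpow hβ).2 (show r1/t1 ∈ Ici 0 from div_nonneg hr1 ht1.le)
    (show r2/t2 ∈ Ici 0 from div_nonneg hr2 ht2.le)
    (show 0 ≤ c * t1 / T by positivity) (show 0 ≤ d * t2 / T by positivity)
    (by rw [← add_div]; exact div_self hT.ne')
  simp only [smul_eq_mul] at h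
  have e : c * t1 / T * (r1/t1) + d * t2/T * (r2/t2) = (c * r1 + d * r2)/T := by
    field_simp
  rw [e] at h
  calc _ ≤ T * _ := mul_le_mul_of_nonneg_left h hT.le
    _ = _ := by field_simp

lemma v15_eq {n : ℕ} (i0 : Fin n) (a b : ℝ) (x : EuclideanSpace ℝ (Fin n))
    (ht : 0 < 2 - x i0) : v15 i0 a b x = √(sq15 i0 x) ^ (2*a) + 
      (2 - x i0) * (√(sq15 i0 x) / (2 - x i0)) ^ (2*b) := by
  have h0 : 0 ≤ sq15 i0 x := Finset.sum_nonneg fun i _ => sq_nonneg _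
  have h1 : ∀ c : ℝ, √(sq15 i0 x) ^ (2*c) = sq15 i0 x ^ c := by
    intro c
    rw [Real.rpow_mul (Real.sqrt_nonneg _)]
    simp [Real.sq_sqrt h0]
  rw [Real.div_rpow (Real.sqrt_nonneg _) ht.le, h1, h1, v15, H15, H15, Real.rpow_zero,
    Real.rpow_sub ht, Real.rpow_one]
  ring

lemma v15_convex {n : ℕ} (i0 : Fin n) (a b : ℝ) (ha : 1/2 < a) (hb : 1/2 < b) 
    (x y : EuclideanSpace ℝ (Fin n)) (hx : 0 < 2 - x i0) (hy : 0 < 2 - y i0) (c d : ℝ)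
    (hc : 0 ≤ c) (hd : 0 ≤ d) (hcd : c + d = 1) (hxy : 0 < 2 - (c • x + d • y) i0) :
    v15 i0 a b (c • x + d • y) ≤ c * v15 i0 a b x + d * v15 i0 a b y := by
  rw [v15_eq _ _ _ _ hx, v15_eq _ _ _ _ hy, v15_eq _ _ _ _ hxy]
  have hr := sqrt15_conv i0 x y c d hc hd
  have n1 := Real.sqrt_nonneg (sq15 i0 x)
  have n2 := Real.sqrt_nonneg (sq15 i0 y)
  have n3 := Real.sqrt_nonneg (sq15 i0 (c • x + d • y))
  have hT : 2 - (c • x + d • y) i0 = c * (2 - x i0) + d * (2 - y i0) := by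
    simp; linear_combination -2 * hcd
  rw [hT] at hxy ⊢
  have p := persp15 (2*b) (by linarith) _ _ _ _ c d n1 n2 hx hy hc hd hcd
  have q := (convexOn_rpow (p := 2*a) (by linarith)).2 (show √(sq15 i0 x) ∈ Ici 0 from n1)
    (show √(sq15 i0 y) ∈ Ici 0 from n2) hc hd hcd
  simp only [smul_eq_mul] at q
  have e1 : √(sq15 i0 (c • x + d • y)) ^ (2*a) ≤ (c * √(sq15 i0 x) + d * √(sq15 i0 y))^(2*a) :=
    Real.rpow_le_rpow n3 hr (by linarith)
  have e2 : (c * (2 - x i0) + d * (2 - y i0)) * (√(sq15 i0 (c • x + d • y)) / 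
      (c * (2 - x i0) + d * (2 - y i0))) ^ (2*b) ≤ (c * (2 - x i0) + d * (2 - y i0)) *
      ((c * √(sq15 i0 x) + d * √(sq15 i0 y)) / (c * (2 - x i0) + d * (2 - y i0))) ^ (2*b) := by
    apply mul_le_mul_of_nonneg_left _ hxy.le
    apply Real.rpow_le_rpow (by positivity) _ (by linarith)
    gcongr
  linarith

/-- the scale-free quantity -/
def G15 (m : ℕ) (p a b : ℝ) (z : ℝ × ℝ) : ℝ :=
  (1 + z.1 ^ (1-2*b) * z.2) ^ (1-p) * (2*a + 2*b*(z.1^(1-2*b) * z.2))^m *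
    (2*a*(2*a-1)*(2*b)*(2*b-1) * z.1^(-(2*b)-1))

lemma G15_bounds (m : ℕ) (p a b : ℝ) (ha : 1/2 < a) (hb : 1/2 < b) :
    ∃ τ1 τ2 : ℝ, 0 < τ1 ∧ τ1 < τ2 ∧ ∀ z ∈ Icc (1:ℝ) 3 ×ˢ Icc (0:ℝ) 1, 
      τ1 ≤ G15 m p a b z ∧ G15 m p a b z ≤ τ2 := by
  have b0 : 0 < b := by linarith
  have a0 : 0 < a := by linarith
  have b1 : 0 < 2 * b - 1 := by linarith
  have a1 : 0 < 2 * a - 1 := by linarith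
  have hK : IsCompact (Icc (1:ℝ) 3 ×ˢ Icc (0:ℝ) 1) := isCompact_Icc.prod isCompact_Icc
  have hne : (Icc (1:ℝ) 3 ×ˢ Icc (0:ℝ) 1).Nonempty := ⟨(1,0), by simp⟩
  have hpos : ∀ z ∈ Icc (1:ℝ) 3 ×ˢ Icc (0:ℝ) 1, 0 < G15 m p a b z := by
    rintro ⟨t, q⟩ ⟨ht, hq⟩
    have : 0 < t := by have := ht.1; simp at this; linarith
    have : 0 ≤ q := hq.1
    unfold G15
    positivity
  have hpw : ∀ e : ℝ, ContinuousOn (fun z : ℝ × ℝ => z.1 ^ e) (Icc (1:ℝ) 3 ×ˢ Icc (0:ℝ) 1) := by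
    intro e
    refine continuousOn_fst.rpow_const ?_
    rintro ⟨t, q⟩ ⟨ht, hq⟩
    left
    have := ht.1; simp at this ⊢; linarith
  have hcont : ContinuousOn (G15 m p a b) (Icc (1:ℝ) 3 ×ˢ Icc (0:ℝ) 1) := by
    unfold G15
    have h1 := (hpw (1-2*b)).mul (continuousOn_snd)
    refine ((ContinuousOn.rpow_const (continuousOn_const.add h1) ?_).mul 
      ((continuousOn_const.add (continuousOn_const.mul h1)).pow m)).mul 
      (continuousOn_const.mul (hpw _))
    rintro ⟨t, q⟩ ⟨ht, hq⟩
    left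
    have : 0 < t := by have := ht.1; simp at this; linarith
    have : 0 ≤ q := hq.1
    have : 0 < 1 + t ^ (1-2*b) * q := by positivity
    exact this.ne'
  obtain ⟨z1, hz1, h1⟩ := hK.exists_isMinOn hne hcont
  obtain ⟨z2, hz2, h2⟩ := hK.exists_isMaxOn hne hcont
  refine ⟨G15 m p a b z1, G15 m p a b z2 + 1, hpos z1 hz1, ?_, fun z hz => ⟨h1 hz, ?_⟩⟩
  · have : G15 m p a b z1 ≤ G15 m p a b z2 := h1 hz2
    linarith
  · have : G15 m p a b z ≤ G15 m p a b z2 := h2 hz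
    linarith

lemma main15 {m : ℕ} (i0 : Fin (m+2)) (p a b : ℝ) (ha : 1/2 < a) (hb : 1/2 < b)
    (hab : b = a * (p - (m+2)) + (m+1))
    (x : EuclideanSpace ℝ (Fin (m+2)))
    (ht : 0 < 2 - x i0) (hs : 0 < sq15 i0 x) :
    v15 i0 a b x ^ (1-p) * (hessMatrix (v15 i0 a b) x).det
      = G15 m p a b (2 - x i0, sq15 i0 x ^ (b-a)) := by
  rw [hess15_det i0 a b ha hb x ht hs]
  unfold v15 H15 G15
  set s := sq15 i0 x with hsd
  set t := 2 - x i0 with htd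
  simp only [Real.rpow_zero, one_mul]
  have e1 : s ^ a + t ^ (1-2*b) * s^b = s^a * (1 + t^(1-2*b) * s^(b-a)) := by
    have : s ^ b = s ^ a * s ^ (b-a) := by rw [← Real.rpow_add hs]; congr 1; ring
    rw [this]; ring
  have e2 : 2 * a * s ^ (a-1) + 2 * b * (t^(1-2*b) * s^(b-1)) 
      = s^(a-1) * (2*a + 2 * b * (t^(1-2*b) * s^(b-a))) := by
    have : s ^ (b-1) = s ^ (a-1) * s ^ (b-a) := by rw [← Real.rpow_add hs]; congr 1; ring
    rw [this]; ring
  rw [e1, e2, Real.mul_rpow (by positivity) (by positivity), mul_pow]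
  have e3 : (s^a)^(1-p) * (s^(a-1))^m * s^(a+b-1) = 1 := by
    rw [← Real.rpow_natCast, ← Real.rpow_mul hs.le, ← Real.rpow_mul hs.le, ← Real.rpow_add hs,
      ← Real.rpow_add hs, hab]
    convert Real.rpow_zero s using 2
    ring
  linear_combination ((1 + t ^ (1-2*b) * s^(b-a)) ^ (1-p) * (2*a + 2*b*(t^(1-2*b) * s^(b-a)))^m *
    (2*a*(2*a-1)*(2*b)*(2*b-1) * t^(-(2*b)-1))) * e3

/-- **Example 3.2.** For any `p > -n + 3` there is a nonnegative convex function on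
`Ω = {(x₁,x₂) : |x₁| < 1, ‖x₂‖ < 1}` vanishing exactly on the 1-dimensional set
`S = Ω ∩ {x₂ = 0}`, which is `C²` off `S` and satisfies
`τ₁ ≤ v^{1-p} det ∇²v ≤ τ₂` on `Ω \ S`. -/
theorem stmt15 {n : ℕ} (hn : 2 ≤ n) {p : ℝ} (hp : -(n : ℝ) + 3 < p)
    (i0 : Fin n) (hi0 : (i0 : ℕ) = 0)
    (Ω : Set (EuclideanSpace ℝ (Fin n)))
    (hΩ : Ω = {x : EuclideanSpace ℝ (Fin n) |
      |x i0| < 1 ∧ Real.sqrt (∑ i ∈ Finset.univ.erase i0, x i ^ 2) < 1})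
    (S : Set (EuclideanSpace ℝ (Fin n)))
    (hS : S = {x ∈ Ω | ∀ i, i ≠ i0 → x i = 0}) :
    ∃ (v : EuclideanSpace ℝ (Fin n) → ℝ) (τ1 τ2 : ℝ),
      0 < τ1 ∧ τ1 < τ2 ∧ ConvexOn ℝ Ω v ∧ (∀ x ∈ Ω, 0 ≤ v x) ∧
      {x ∈ Ω | v x = 0} = S ∧ ContDiffOn ℝ 2 v (Ω \ S) ∧
      ∀ x ∈ Ω \ S, τ1 ≤ v x ^ (1 - p) * (hessMatrix v x).det ∧
        v x ^ (1 - p) * (hessMatrix v x).det ≤ τ2 := by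
  obtain ⟨m, rfl⟩ : ∃ m, n = m + 2 := ⟨n - 2, by omega⟩
  push_cast at hp
  obtain ⟨a, b, ha, hab, hb⟩ : ∃ a b : ℝ, 1/2 < a ∧ a < b ∧ b = a * (p - (m+2)) + (m+1) := by
    set e := (m:ℝ) + 2 - 3 + p with he
    have he0 : 0 < e := by linarith
    have hm : (0:ℝ) ≤ m := Nat.cast_nonneg m
    have hN : (0:ℝ) < 4 * (m+2) := by linarith
    set δ := e / (4 * (m+2)) with hδ
    have hδ0 : 0 < δ := div_pos he0 hN
    have hδe : δ * (4 * (m+2)) = e := div_mul_cancel₀ _ hN.ne'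
    refine ⟨1/2 + δ, _, by linarith, ?_, rfl⟩
    have hp' : p = e + 1 - m := by linarith
    rw [hp']
    nlinarith [mul_pos hδ0 he0]
  have hb2 : 1/2 < b := by linarith
  obtain ⟨τ1, τ2, h1, h2, h3⟩ := G15_bounds m p a b ha hb2
  have hΩ' : ∀ x, x ∈ Ω ↔ |x i0| < 1 ∧ √(sq15 i0 x) < 1 := by
    intro x; rw [hΩ]; rfl
  have hs0 : ∀ x, 0 ≤ sq15 i0 x := fun x => Finset.sum_nonneg fun i _ => sq_nonneg _
  have hpos : ∀ x ∈ Ω, 0 < 2 - x i0 := by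
    intro x hx
    have := (abs_lt.1 ((hΩ' x).1 hx).1).2
    linarith
  have hS' : ∀ x, x ∈ S ↔ x ∈ Ω ∧ sq15 i0 x = 0 := by
    intro x
    rw [hS]
    refine and_congr_right fun _ => ?_
    rw [sq15, Finset.sum_eq_zero_iff_of_nonneg fun i _ => sq_nonneg _]
    simp
  have hsp : ∀ x ∈ Ω \ S, 0 < sq15 i0 x := by
    intro x hx
    refine lt_of_le_of_ne (hs0 x) fun h => hx.2 ((hS' x).2 ⟨hx.1, h.symm⟩)
  have hconv : Convex ℝ Ω := by
    intro x hx y hy c d hc hd hcd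
    rw [hΩ'] at hx hy ⊢
    constructor
    · have h := (convex_Ioo (-1:ℝ) 1) (abs_lt.1 hx.1) (abs_lt.1 hy.1) hc hd hcd
      rw [abs_lt]
      simpa using h
    · refine (sqrt15_conv i0 x y c d hc hd).trans_lt ?_
      have h := (convex_Iio (1:ℝ)) hx.2 hy.2 hc hd hcd
      simpa using h
  have ha0 : a ≠ 0 := by linarith
  have hb0 : b ≠ 0 := by linarith
  refine ⟨v15 i0 a b, τ1, τ2, h1, h2, ⟨hconv, ?_⟩, ?_, ?_, ?_, ?_⟩
  · intro x hx y hy c d hc hd hcd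
    exact v15_convex i0 a b ha hb2 x y (hpos x hx) (hpos y hy) c d hc hd hcd
      (hpos _ (hconv hx hy hc hd hcd))
  · intro x hx
    have := hpos x hx
    have := hs0 x
    unfold v15 H15
    positivity
  · ext x
    rw [hS' x]
    refine and_congr_right fun hx => ?_
    have h2 := hpos x hx
    constructor
    · intro hv
      by_contra hne
      have h3 : 0 < sq15 i0 x := lt_of_le_of_ne (hs0 x) (Ne.symm hne)
      have : 0 < v15 i0 a b x := by unfold v15 H15; positivity
      linarith
    · intro h
      simp [v15, H15, h, Real.zero_rpow ha0, Real.zero_rpow hb0]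
  · intro x hx
    exact ((H15_contDiffAt i0 _ _ x (hpos x hx.1) (hsp x hx)).add
      (H15_contDiffAt i0 _ _ x (hpos x hx.1) (hsp x hx))).contDiffWithinAt
  · intro x hx
    rw [main15 i0 p a b ha hb2 hb x (hpos x hx.1) (hsp x hx)]
    apply h3
    have h4 := (hΩ' x).1 hx.1
    have h5 := abs_lt.1 h4.1
    have h6 : sq15 i0 x < 1 := by
      have := h4.2
      rwa [Real.sqrt_lt' one_pos, one_pow] at this
    refine ⟨⟨?_, ?_⟩, ⟨?_, ?_⟩⟩
    · show 1 ≤ 2 - x i0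
      linarith [h5.2]
    · show 2 - x i0 ≤ 3
      linarith [h5.1]
    · exact Real.rpow_nonneg (hs0 x) _
    · exact Real.rpow_le_one (hs0 x) h6.le (by linarith)
end
end
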